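/- arXiv:1102.3205 — 3 statements merged into one kernel-verified Lean document; each statement's English description precedes it below -/
import Mathlib

section
/- Let F be a differential field of characteristic zero with field of constants C, let f₁, …, fₙ ∈ F satisfy condition (C), and let F ⊆ E be an extension of differential fields with E = F(x_{i,j} : 1 ≤ i ≤ n, 1 ≤ j ≤ n+1−i), where the x_{i,j} are algebraically independent over F and x_{1,j}′ = f_j, x_{i,j}′ = f_j · x_{i−1, j+1} for 2 ≤ i ≤ n. Let N be the subfield of E generated over the differential subfield F⟨x_{n,1}⟩ by x_{1,1}, …, x_{1,n}. Then every constant of N lies in C; that is, N is a no new constants extension of F. -/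
/-- The smallest differential subfield of `E` (with respect to the derivation `D`)
containing the subfield `F` and the set `S`; written `F⟨S⟩` in the paper. -/
def diffAdjoin (E : Type) [Field E] [CharZero E] (D : Derivation ℚ E E)
    (F : Subfield E) (S : Set E) : Subfield E :=
  sInf {K : Subfield E | F ≤ K ∧ S ⊆ K ∧ ∀ a ∈ K, D a ∈ K}

open MvPolynomial

namespace IteratedIntegral

/-- Indices `(i, j)` with `1 ≤ i`, `1 ≤ j`, `i + j ≤ n + 1`. -/
abbrev Index (n : ℕ) : Type := {p : ℕ × ℕ // 1 ≤ p.1 ∧ 1 ≤ p.2 ∧ p.1 + p.2 ≤ n + 1}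

instance (n : ℕ) : Finite (Index n) :=
  Set.Finite.to_subtype <| (Set.finite_Iic ((n, n) : ℕ × ℕ)).subset fun p hp => by
    simp only [Set.mem_Iic, Prod.le_def]
    have h := Set.mem_ofPred.mp hp
    omega

noncomputable instance (n : ℕ) : Fintype (Index n) := Fintype.ofFinite _

/-- The weight of the variable `x_{i,j}` is `i`. -/
def wt (n : ℕ) (p : Index n) : ℕ := p.1.1

section Polynomial

variable {K : Type*} [Field K] {n : ℕ}

section Coefficientwise

variable {σ : Type*}

/-- Apply a derivation of the coefficient field to every coefficient. -/
noncomputable def coeffDeriv [CharZero K] (d : Derivation ℚ K K) (p : MvPolynomial σ K) :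
    MvPolynomial σ K :=
  AddMonoidAlgebra.map (d : K →+ K) p

variable [CharZero K] (d : Derivation ℚ K K)

@[simp]
theorem coeff_coeffDeriv (p : MvPolynomial σ K) (m : σ →₀ ℕ) :
    coeff m (coeffDeriv d p) = d (coeff m p) := rfl

theorem coeffDeriv_add (p q : MvPolynomial σ K) :
    coeffDeriv d (p + q) = coeffDeriv d p + coeffDeriv d q := by
  ext m; simp

@[simp]
theorem coeffDeriv_zero : coeffDeriv d (0 : MvPolynomial σ K) = 0 := by
  ext m; simp

theorem coeffDeriv_sum {ι : Type*} (s : Finset ι) (p : ι → MvPolynomial σ K) :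
    coeffDeriv d (∑ i ∈ s, p i) = ∑ i ∈ s, coeffDeriv d (p i) := by
  ext m; simp [coeff_sum]

theorem coeffDeriv_C (a : K) : coeffDeriv d (C a : MvPolynomial σ K) = C (d a) := by
  classical
  ext m
  simp only [coeff_coeffDeriv, coeff_C]
  split_ifs <;> simp

theorem coeffDeriv_C_mul (a : K) (p : MvPolynomial σ K) :
    coeffDeriv d (C a * p) = C (d a) * p + C a * coeffDeriv d p := by
  ext m
  simp only [coeff_coeffDeriv, coeff_add, coeff_C_mul, Derivation.leibniz, smul_eq_mul]
  ring

theorem coeffDeriv_mul_X (p : MvPolynomial σ K) (i : σ) :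
    coeffDeriv d (p * X i) = coeffDeriv d p * X i := by
  classical
  ext m
  simp only [coeff_coeffDeriv, coeff_mul_X']
  split_ifs <;> simp

theorem coeffDeriv_pderiv (p : MvPolynomial σ K) (i : σ) :
    coeffDeriv d (pderiv i p) = pderiv i (coeffDeriv d p) := by
  ext m
  simp only [coeff_coeffDeriv, coeff_pderiv, Derivation.leibniz, smul_eq_mul, map_add,
    Derivation.map_natCast, Derivation.map_one_eq_zero]
  ring

theorem weightedHomogeneousComponent_coeffDeriv (w : σ → ℕ) (e : ℕ) (p : MvPolynomial σ K) :
    weightedHomogeneousComponent w e (coeffDeriv d p) =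
      coeffDeriv d (weightedHomogeneousComponent w e p) := by
  classical
  ext m
  simp only [coeff_coeffDeriv, coeff_weightedHomogeneousComponent]
  split_ifs <;> simp

theorem totalDegree_coeffDeriv_le (p : MvPolynomial σ K) :
    (coeffDeriv d p).totalDegree ≤ p.totalDegree := by
  refine Finset.sup_mono fun m hm => ?_
  rw [mem_support_iff] at hm ⊢
  contrapose! hm
  simp [hm]

/-- In characteristic zero a polynomial with vanishing partial derivatives is constant. -/
theorem eq_C_of_pderiv_eq_zero {p : MvPolynomial σ K} (h : ∀ i, pderiv i p = 0) :
    p = C (coeff 0 p) := by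
  classical
  ext m
  rw [coeff_C]
  split_ifs with h0
  · rw [h0]
  · obtain ⟨i, hi⟩ : ∃ i, m i ≠ 0 := by
      by_contra! hm
      exact h0 (Finsupp.ext fun i => (hm i).symm)
    have h1 := coeff_pderiv (i := i) p (m - Finsupp.single i 1)
    rw [h i, coeff_zero, Finsupp.sub_add_single_one_cancel hi] at h1
    exact (mul_eq_zero.mp h1.symm).resolve_right (Nat.cast_add_one_ne_zero _)

end Coefficientwise

theorem derivation_sum_apply {R A M ι : Type*} [CommSemiring R] [CommSemiring A] [Algebra R A]
    [AddCommMonoid M] [Module A M] [Module R M] (s : Finset ι) (T : ι → Derivation R A M) (a : A) :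
    (∑ i ∈ s, T i) a = ∑ i ∈ s, T i a := by
  classical
  induction s using Finset.induction_on with
  | empty => rfl
  | insert i s hi ih => rw [Finset.sum_insert hi, Finset.sum_insert hi, Derivation.add_apply, ih]

theorem derivation_eq_sum_pderiv {σ : Type*} [Fintype σ]
    (T : Derivation K (MvPolynomial σ K) (MvPolynomial σ K)) (p : MvPolynomial σ K) :
    T p = ∑ i, T (X i) * pderiv i p := by
  classical
  have h : T = ∑ i, T (X i) • pderiv i := by
    refine derivation_ext fun j => ?_
    simp [derivation_sum_apply, pderiv_X, Pi.single_apply]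
  conv_lhs => rw [h]
  simp [derivation_sum_apply]

theorem totalDegree_mul_pderiv_le {σ : Type*} {y : MvPolynomial σ K} (hy : y.totalDegree ≤ 1)
    (p : MvPolynomial σ K) (i : σ) : (y * pderiv i p).totalDegree ≤ p.totalDegree := by
  by_cases h : pderiv i p = 0
  · simp [h]
  · have h1 : (pderiv i p).totalDegree + 1 ≤ p.totalDegree := by
      obtain ⟨m, hm, hm'⟩ := Finset.exists_mem_eq_sup _ (support_nonempty.mpr h)
        (fun m : σ →₀ ℕ => m.sum fun _ e => e)
      have h2 : m + Finsupp.single i 1 ∈ p.support := by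
        rw [mem_support_iff, coeff_pderiv] at hm
        exact mem_support_iff.mpr (left_ne_zero_of_mul hm)
      have h3 := le_totalDegree h2
      rw [Finsupp.sum_add_index' (fun _ => rfl) (fun _ _ _ => rfl),
        Finsupp.sum_single_index rfl] at h3
      rw [totalDegree, hm']
      exact h3
    have := totalDegree_mul y (pderiv i p)
    omega

variable (K n) in
/-- The variable `x_{i,j}`, with `x_{0,j} = 1` and value `0` outside the triangle. -/
noncomputable def var (i j : ℕ) : MvPolynomial (Index n) K :=
  if i = 0 then 1 else
    if h : 1 ≤ i ∧ 1 ≤ j ∧ i + j ≤ n + 1 then X ⟨(i, j), h⟩ else 0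

@[simp]
theorem var_zero (j : ℕ) : var K n 0 j = 1 := by simp [var]

theorem var_of_mem {i j : ℕ} (h : 1 ≤ i ∧ 1 ≤ j ∧ i + j ≤ n + 1) :
    var K n i j = X ⟨(i, j), h⟩ := by
  rw [var, if_neg (by omega), dif_pos h]

variable (K n) in
/-- The derivation `x_{i,k} ↦ x_{i-m,k+m}` for `i ≥ m`, which kills all other variables.
For `m = 1` it removes the first letter `k` of a word. -/
noncomputable def shift (k m : ℕ) :
    Derivation K (MvPolynomial (Index n) K) (MvPolynomial (Index n) K) :=
  mkDerivation K fun p => if p.1.2 = k ∧ m ≤ p.1.1 then var K n (p.1.1 - m) (k + m) else 0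

theorem shift_X (k m : ℕ) (p : Index n) :
    shift K n k m (X p) = if p.1.2 = k ∧ m ≤ p.1.1 then var K n (p.1.1 - m) (k + m) else 0 :=
  mkDerivation_X ..

theorem shift_var_of_ne {k m i j : ℕ} (h : j ≠ k) : shift K n k m (var K n i j) = 0 := by
  unfold var
  split_ifs with h0 h1
  · simp
  · rw [shift_X, if_neg (by simp [h])]
  · simp

theorem shift_var_self {k m i : ℕ} (hm : 1 ≤ m) (h : 1 ≤ k ∧ i + k ≤ n + 1) :
    shift K n k m (var K n i k) = if m ≤ i then var K n (i - m) (k + m) else 0 := by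
  rcases Nat.eq_zero_or_pos i with rfl | hi
  · rw [if_neg (by omega)]; simp
  · rw [var_of_mem ⟨hi, h⟩, shift_X]; simp

theorem shift_succ (k : ℕ) {m : ℕ} (hm : 1 ≤ m) :
    shift K n k (m + 1) = ⁅shift K n (k + m) 1, shift K n k m⁆ := by
  refine derivation_ext fun p => ?_
  obtain ⟨⟨i, j⟩, hi, hj, hij⟩ := p
  dsimp only at hi hj hij
  rw [Derivation.commutator_apply]
  simp only [shift_X]
  by_cases hjk : j = k
  · subst hjk
    rw [if_neg (show ¬ (j = j + m ∧ 1 ≤ i) by omega), map_zero, sub_zero]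
    by_cases hmi : m ≤ i
    · rw [if_pos (show j = j ∧ m ≤ i from ⟨rfl, hmi⟩), shift_var_self le_rfl (by omega)]
      simp only [true_and]
      by_cases h1 : m + 1 ≤ i
      · rw [if_pos h1, if_pos (by omega), Nat.sub_sub, add_assoc]
      · rw [if_neg h1, if_neg (by omega)]
    · rw [if_neg (by omega), if_neg (by omega), map_zero]
  · rw [if_neg (by omega), if_neg (by omega), map_zero, zero_sub]
    split_ifs with h
    · rw [shift_var_of_ne (by omega), neg_zero]
    · simp

theorem shift_eq_zero_of_first {u : MvPolynomial (Index n) K}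
    (h : ∀ k, shift K n k 1 u = 0) {m : ℕ} (hm : 1 ≤ m) (k : ℕ) : shift K n k m u = 0 := by
  induction m, hm using Nat.le_induction with
  | base => exact h k
  | succ m hm ih => rw [shift_succ k hm, Derivation.commutator_apply, ih, h]; simp

theorem pderiv_eq_zero_of_shift {u : MvPolynomial (Index n) K}
    (h : ∀ k, shift K n k 1 u = 0) (p : Index n) : pderiv p u = 0 := by
  suffices H : ∀ b, ∀ p : Index n, n - p.1.1 = b → pderiv p u = 0 from H _ p rfl
  intro b
  induction b using Nat.strong_induction_on with
  | _ b ih =>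
    intro p hp
    have h1 := shift_eq_zero_of_first h p.2.1 p.1.2
    rw [derivation_eq_sum_pderiv, Finset.sum_eq_single p] at h1
    · simpa [shift_X] using h1
    · intro q _ hq
      rw [shift_X]
      split_ifs with hc
      · have h2 : p.1.1 < q.1.1 := by
          refine lt_of_le_of_ne hc.2 fun h3 => hq (Subtype.ext (Prod.ext h3.symm hc.1))
        have h4 := q.2
        rw [ih (n - q.1.1) (by omega) q rfl, mul_zero]
      · rw [zero_mul]
    · simp

theorem totalDegree_var_le (i j : ℕ) : (var K n i j).totalDegree ≤ 1 := by
  unfold var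
  split_ifs <;> simp

theorem totalDegree_shift_le (k m : ℕ) (p : MvPolynomial (Index n) K) :
    (shift K n k m p).totalDegree ≤ p.totalDegree := by
  rw [derivation_eq_sum_pderiv]
  refine totalDegree_finsetSum_le fun i _ => totalDegree_mul_pderiv_le ?_ p i
  rw [shift_X]
  split_ifs
  · exact totalDegree_var_le _ _
  · simp

theorem isWeightedHomogeneous_var (i j : ℕ) : IsWeightedHomogeneous (wt n) (var K n i j) i := by
  unfold var
  split_ifs with h0 h1
  · subst h0; exact isWeightedHomogeneous_one _ _
  · exact isWeightedHomogeneous_X K (wt n) ⟨(i, j), h1⟩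
  · exact isWeightedHomogeneous_zero ..

theorem nonTorsionWeight_wt : NonTorsionWeight (wt n) :=
  nonTorsionWeight_of fun p => Nat.one_le_iff_ne_zero.mp p.2.1

theorem pderiv_eq_zero_of_lt {σ : Type*} {w : σ → ℕ} {e : ℕ} {p : MvPolynomial σ K}
    (hp : IsWeightedHomogeneous w p e) {i : σ} (hi : e < w i) : pderiv i p = 0 := by
  ext m
  rw [coeff_pderiv, coeff_zero, hp.coeff_eq_zero, zero_mul]
  rw [map_add, Finsupp.weight_single]
  simp only [smul_eq_mul]
  omega

theorem isWeightedHomogeneous_shift {e : ℕ} {p : MvPolynomial (Index n) K}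
    (hp : IsWeightedHomogeneous (wt n) p (e + 1)) (k : ℕ) :
    IsWeightedHomogeneous (wt n) (shift K n k 1 p) e := by
  rw [derivation_eq_sum_pderiv]
  refine IsWeightedHomogeneous.sum _ _ _ fun i _ => ?_
  by_cases hi : e + 1 < wt n i
  · rw [pderiv_eq_zero_of_lt hp hi, mul_zero]
    exact isWeightedHomogeneous_zero ..
  · rw [shift_X]
    split_ifs with hc
    · have h1 : (i.1.1 - 1) + (e + 1 - wt n i) = e := by
        have := hc.2
        unfold wt at hi ⊢
        omega
      rw [← h1]
      exact (isWeightedHomogeneous_var _ _).mul (hp.pderiv (by omega))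
    · rw [zero_mul]
      exact isWeightedHomogeneous_zero ..

theorem exists_mem_support_weight_eq {p : MvPolynomial (Index n) K} (hp : p ≠ 0) :
    ∃ m ∈ p.support, Finsupp.weight (wt n) m = weightedTotalDegree (wt n) p := by
  obtain ⟨m, hm, hm'⟩ := Finset.exists_mem_eq_sup _ (support_nonempty.mpr hp)
    (fun m => Finsupp.weight (wt n) m)
  exact ⟨m, hm, hm'.symm⟩

theorem weightedHomogeneousComponent_shift (e k : ℕ) (p : MvPolynomial (Index n) K) :
    weightedHomogeneousComponent (wt n) e (shift K n k 1 p) =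
      shift K n k 1 (weightedHomogeneousComponent (wt n) (e + 1) p) := by
  induction p using MvPolynomial.induction_on' with
  | add p q hp hq => simp only [map_add, hp, hq]
  | monomial m a =>
    have hm := isWeightedHomogeneous_monomial (wt n) m a rfl
    rcases h : Finsupp.weight (wt n) m with _ | b
    · have hm0 : m = 0 := Finsupp.ext ((weightedDegree_eq_zero_iff nonTorsionWeight_wt).mp h)
      rw [h] at hm
      rw [hm.weightedHomogeneousComponent_ne (e + 1) (by omega), hm0]
      simp [← C_apply, derivation_C]
    · rw [h] at hm
      have hs := isWeightedHomogeneous_shift hm k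
      by_cases hb : e = b
      · subst hb
        rw [hs.weightedHomogeneousComponent_same, hm.weightedHomogeneousComponent_same]
      · rw [hs.weightedHomogeneousComponent_ne e hb,
          hm.weightedHomogeneousComponent_ne (e + 1) (by omega), map_zero]

variable [CharZero K] (d : Derivation ℚ K K)

theorem coeffDeriv_var_mul (i j : ℕ) (p : MvPolynomial (Index n) K) :
    coeffDeriv d (var K n i j * p) = var K n i j * coeffDeriv d p := by
  unfold var
  split_ifs
  · simp
  · rw [mul_comm, coeffDeriv_mul_X, mul_comm]
  · simp

theorem coeffDeriv_shift (k m : ℕ) (p : MvPolynomial (Index n) K) :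
    coeffDeriv d (shift K n k m p) = shift K n k m (coeffDeriv d p) := by
  rw [derivation_eq_sum_pderiv, derivation_eq_sum_pderiv _ (coeffDeriv d p), coeffDeriv_sum]
  refine Finset.sum_congr rfl fun i _ => ?_
  rw [shift_X]
  split_ifs
  · rw [coeffDeriv_var_mul, coeffDeriv_pderiv]
  · simp

variable (n) in
/-- The derivation of `K[x_{i,j}]` extending `d` with `x_{i,j}' = f_j x_{i-1,j+1}`. -/
noncomputable def totalDeriv (f : ℕ → K) (p : MvPolynomial (Index n) K) :
    MvPolynomial (Index n) K :=
  coeffDeriv d p + ∑ k ∈ Finset.Icc 1 n, C (f k) * shift K n k 1 p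

variable {d} {f : ℕ → K}

theorem totalDeriv_C_mul (a : K) (p : MvPolynomial (Index n) K) :
    totalDeriv n d f (C a * p) = C (d a) * p + C a * totalDeriv n d f p := by
  simp only [totalDeriv, coeffDeriv_C_mul, mul_add, Finset.mul_sum]
  rw [add_assoc]
  congr 2
  exact Finset.sum_congr rfl fun k _ => by
    rw [show C a * p = a • p from C_mul', Derivation.map_smul, ← C_mul', mul_left_comm]

theorem totalDegree_totalDeriv_le (p : MvPolynomial (Index n) K) :
    (totalDeriv n d f p).totalDegree ≤ p.totalDegree := by
  refine (totalDegree_add _ _).trans (max_le (totalDegree_coeffDeriv_le d p) ?_)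
  refine totalDegree_finsetSum_le fun k _ => (totalDegree_mul _ _).trans ?_
  rw [totalDegree_C, zero_add]
  exact totalDegree_shift_le ..

theorem weightedHomogeneousComponent_totalDeriv (e : ℕ) (p : MvPolynomial (Index n) K) :
    weightedHomogeneousComponent (wt n) e (totalDeriv n d f p) =
      coeffDeriv d (weightedHomogeneousComponent (wt n) e p) +
        ∑ k ∈ Finset.Icc 1 n,
          C (f k) * shift K n k 1 (weightedHomogeneousComponent (wt n) (e + 1) p) := by
  simp only [totalDeriv, map_add, weightedHomogeneousComponent_coeffDeriv, map_sum,
    weightedHomogeneousComponent_C_mul, weightedHomogeneousComponent_shift]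

theorem weightedHomogeneousComponent_totalDeriv_top (p : MvPolynomial (Index n) K) :
    weightedHomogeneousComponent (wt n) (weightedTotalDegree (wt n) p) (totalDeriv n d f p) =
      coeffDeriv d (weightedHomogeneousComponent (wt n) (weightedTotalDegree (wt n) p) p) := by
  rw [weightedHomogeneousComponent_totalDeriv,
    weightedHomogeneousComponent_eq_zero _ _ (Nat.lt_succ_self _)]
  simp

theorem eq_C_of_totalDeriv_eq_zero
    (hC : ∀ (c : ℕ → K) (g : K), (∀ j, 1 ≤ j → j ≤ n → d (c j) = 0) →
      (∑ j ∈ Finset.Icc 1 n, c j * f j) = d g → ∀ j, 1 ≤ j → j ≤ n → c j = 0)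
    {p : MvPolynomial (Index n) K}
    (hp : totalDeriv n d f p = 0) : ∃ a, p = C a := by
  classical
  by_cases hp0 : p = 0
  · exact ⟨0, by simp [hp0]⟩
  obtain ⟨m₀, hm₀, hw⟩ := exists_mem_support_weight_eq hp0
  have htop := weightedHomogeneousComponent_totalDeriv_top (d := d) (f := f) p
  rcases hW : weightedTotalDegree (wt n) p with _ | e
  · rw [weightedTotalDegree_eq_zero_iff nonTorsionWeight_wt] at hW
    refine ⟨coeff 0 p, ?_⟩
    ext m
    rw [coeff_C]
    split_ifs with h
    · rw [h]
    · by_contra hm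
      exact h (Finsupp.ext fun i => (hW m (mem_support_iff.mpr hm) i).symm)
  · exfalso
    rw [hW] at htop hw
    set u := weightedHomogeneousComponent (wt n) (e + 1) p with hu
    have hdu : coeffDeriv d u = 0 := by rw [← htop, hp, map_zero]
    have hsub := weightedHomogeneousComponent_totalDeriv (d := d) (f := f) e p
    rw [hp, map_zero, ← hu] at hsub
    have hshift : ∀ k, shift K n k 1 u = 0 := by
      intro k
      by_cases hk : 1 ≤ k ∧ k ≤ n
      · ext m
        refine hC (fun j => coeff m (shift K n j 1 u))
          (-coeff m (weightedHomogeneousComponent (wt n) e p)) (fun j _ _ => ?_) ?_ k hk.1 hk.2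
        · rw [← coeff_coeffDeriv, coeffDeriv_shift, hdu, map_zero, coeff_zero]
        · have := congrArg (coeff m) hsub
          simp only [coeff_zero, coeff_add, coeff_coeffDeriv, coeff_sum, coeff_C_mul] at this
          rw [map_neg, eq_neg_iff_add_eq_zero, add_comm, this]
          simp only [mul_comm]
      · have : shift K n k 1 = 0 := by
          refine derivation_ext fun q => ?_
          have := q.2
          rw [shift_X, if_neg (by omega)]
          rfl
        simp [this]
    have hconst := eq_C_of_pderiv_eq_zero (pderiv_eq_zero_of_shift hshift)
    have h1 : coeff m₀ u ≠ 0 := by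
      rw [hu, coeff_weightedHomogeneousComponent, if_pos hw]
      exact mem_support_iff.mp hm₀
    rw [hconst, coeff_C] at h1
    have h2 : m₀ = 0 := by
      by_contra h
      exact h1 (if_neg (Ne.symm h))
    rw [h2, map_zero] at hw
    omega

theorem eq_C_of_dvd_totalDeriv
    (hC : ∀ (c : ℕ → K) (g : K), (∀ j, 1 ≤ j → j ≤ n → d (c j) = 0) →
      (∑ j ∈ Finset.Icc 1 n, c j * f j) = d g → ∀ j, 1 ≤ j → j ≤ n → c j = 0)
    {p : MvPolynomial (Index n) K} (hp0 : p ≠ 0)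
    (hp : p ∣ totalDeriv n d f p) : ∃ a, p = C a := by
  classical
  obtain ⟨m₀, hm₀, hw⟩ := exists_mem_support_weight_eq hp0
  have hc := mem_support_iff.mp hm₀
  set c := coeff m₀ p
  obtain ⟨h, hh⟩ := hp
  have hh0 : h = C (coeff 0 h) := by
    by_cases h0 : h = 0
    · simp [h0]
    · have := totalDegree_totalDeriv_le (d := d) (f := f) p
      rw [hh, totalDegree_mul_of_isDomain hp0 h0] at this
      exact totalDegree_eq_zero_iff_eq_C.mp (by omega)
  have hcoef : c * coeff 0 h = d c := by
    have := congrArg (coeff m₀) (weightedHomogeneousComponent_totalDeriv_top (d := d) (f := f) p)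
    rw [coeff_coeffDeriv, coeff_weightedHomogeneousComponent, if_pos hw,
      coeff_weightedHomogeneousComponent, if_pos hw, hh, hh0, mul_comm, coeff_C_mul] at this
    rw [mul_comm]
    exact this
  have hzero : totalDeriv n d f (C c⁻¹ * p) = 0 := by
    rw [totalDeriv_C_mul, hh, hh0, Derivation.leibniz_inv, ← hcoef]
    have : C c⁻¹ * (p * C (coeff 0 h)) = C (c⁻¹ * coeff 0 h) * p := by
      rw [C_mul]; ring
    rw [this, ← add_mul, ← C_add]
    have : -c⁻¹ ^ 2 • (c * coeff 0 h) + c⁻¹ * coeff 0 h = 0 := by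
      simp only [smul_eq_mul]
      field_simp
      ring
    rw [this, C_0, zero_mul]
  obtain ⟨a, ha⟩ := eq_C_of_totalDeriv_eq_zero hC hzero
  refine ⟨c * a, ?_⟩
  rw [C_mul, ← ha, ← mul_assoc, ← C_mul, mul_inv_cancel₀ hc, C_1, one_mul]

end Polynomial

section Extension

variable {E : Type*} [Field E] [CharZero E]

/-- The restriction of a derivation to a differential subfield. -/
def restrictDeriv (D : Derivation ℚ E E) (F : Subfield E) (hF : ∀ a ∈ F, D a ∈ F) :
    Derivation ℚ F F :=
  Derivation.mk'
    { toFun := fun a => ⟨D a, hF a a.2⟩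
      map_add' := fun a b => Subtype.ext (by simp)
      map_smul' := fun r a => Subtype.ext (by
        change D (r • (a : E)) = r • D a
        exact D.map_smul r _) }
    fun a b => Subtype.ext (by simp)

@[simp]
theorem coe_restrictDeriv (D : Derivation ℚ E E) (F : Subfield E) (hF : ∀ a ∈ F, D a ∈ F)
    (a : F) : (restrictDeriv D F hF a : E) = D a := rfl

theorem aeval_totalDeriv (D : Derivation ℚ E E) (F : Subfield E) (hF : ∀ a ∈ F, D a ∈ F)
    {n : ℕ} (f : ℕ → F) (x : ℕ → ℕ → E)
    (hd1 : ∀ j, 1 ≤ j → j ≤ n → D (x 1 j) = f j)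
    (hdi : ∀ i j, 2 ≤ i → 1 ≤ j → i + j ≤ n + 1 → D (x i j) = f j * x (i - 1) (j + 1))
    (p : MvPolynomial (Index n) F) :
    aeval (fun q : Index n => x q.1.1 q.1.2) (totalDeriv n (restrictDeriv D F hF) f p) =
      D (aeval (fun q : Index n => x q.1.1 q.1.2) p) := by
  induction p using MvPolynomial.induction_on with
  | C a =>
    simp only [totalDeriv, coeffDeriv_C, derivation_C, mul_zero, Finset.sum_const_zero, add_zero,
      aeval_C]
    rfl
  | add p q hp hq =>
    rw [map_add, map_add, ← hp, ← hq, ← map_add]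
    congr 1
    simp only [totalDeriv, coeffDeriv_add, map_add, mul_add, Finset.sum_add_distrib]
    ring
  | mul_X p q hp =>
    have h1 : totalDeriv n (restrictDeriv D F hF) f (p * X q) =
        totalDeriv n (restrictDeriv D F hF) f p * X q +
          p * (C (f q.1.2) * var F n (q.1.1 - 1) (q.1.2 + 1)) := by
      simp only [totalDeriv, coeffDeriv_mul_X, Derivation.leibniz, smul_eq_mul, mul_add,
        Finset.sum_add_distrib, add_mul, Finset.sum_mul]
      rw [Finset.sum_eq_single q.1.2]
      · rw [shift_X, if_pos ⟨rfl, q.2.1⟩]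
        have : ∀ k, C (f k) * (X q * shift F n k 1 p) = C (f k) * shift F n k 1 p * X q :=
          fun k => by ring
        simp only [this]
        ring
      · intro k _ hk
        rw [shift_X, if_neg (by tauto)]
        simp
      · intro hq
        have := q.2
        exact absurd (Finset.mem_Icc.mpr (by omega)) hq
    rw [h1, map_add, map_mul, hp, map_mul, map_mul, map_mul, Derivation.leibniz, aeval_X, aeval_C]
    simp only [smul_eq_mul]
    obtain ⟨⟨i, j⟩, hi, hj, hij⟩ := q
    dsimp only at hi hj hij ⊢
    have h2 : D (x i j) = algebraMap F E (f j) *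
        aeval (fun q : Index n => x q.1.1 q.1.2) (var F n (i - 1) (j + 1)) := by
      rcases Nat.eq_or_lt_of_le hi with rfl | hi
      · rw [hd1 j hj (by omega)]
        simp
        rfl
      · rw [hdi i j hi hj hij, var_of_mem (by omega), aeval_X]
        rfl
    rw [h2]
    ring

/-- The field `E = F(x_{i,j})` has no constants outside `F`. -/
theorem mem_of_deriv_eq_zero (D : Derivation ℚ E E) (F : Subfield E) (hF : ∀ a ∈ F, D a ∈ F)
    {n : ℕ} (f : ℕ → F)
    (hC : ∀ (c : ℕ → F) (g : F), (∀ j, 1 ≤ j → j ≤ n → restrictDeriv D F hF (c j) = 0) →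
      (∑ j ∈ Finset.Icc 1 n, c j * f j) = restrictDeriv D F hF g →
      ∀ j, 1 ≤ j → j ≤ n → c j = 0)
    (x : ℕ → ℕ → E)
    (hind : AlgebraicIndependent F (fun p : Index n => x p.1.1 p.1.2))
    (hgen : Subfield.closure
      (↑F ∪ {a | ∃ i j, 1 ≤ i ∧ 1 ≤ j ∧ i + j ≤ n + 1 ∧ a = x i j}) = ⊤)
    (hd1 : ∀ j, 1 ≤ j → j ≤ n → D (x 1 j) = f j)
    (hdi : ∀ i j, 2 ≤ i → 1 ≤ j → i + j ≤ n + 1 → D (x i j) = f j * x (i - 1) (j + 1))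
    {c : E} (hc : D c = 0) : c ∈ F := by
  set φ := aeval (R := F) (fun q : Index n => x q.1.1 q.1.2) with hφ
  have hinj : Function.Injective φ := hind
  have hsub : Subring.closure (↑F ∪ {a | ∃ i j, 1 ≤ i ∧ 1 ≤ j ∧ i + j ≤ n + 1 ∧ a = x i j}) ≤
      φ.range.toSubring := by
    refine Subring.closure_le.mpr (Set.union_subset (fun a ha => ?_) ?_)
    · exact ⟨C ⟨a, ha⟩, aeval_C _ _⟩
    · rintro _ ⟨i, j, hi, hj, hij, rfl⟩
      exact ⟨X ⟨(i, j), hi, hj, hij⟩, aeval_X _ _⟩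
  have hmem : c ∈ Subfield.closure
      (↑F ∪ {a | ∃ i j, 1 ≤ i ∧ 1 ≤ j ∧ i + j ≤ n + 1 ∧ a = x i j}) := hgen ▸ Subfield.mem_top c
  obtain ⟨y, hy, z, hz, rfl⟩ := Subfield.mem_closure_iff.mp hmem
  obtain ⟨p, rfl⟩ := hsub hy
  obtain ⟨q, rfl⟩ := hsub hz
  change φ p / φ q ∈ F
  change D (φ p / φ q) = 0 at hc
  by_cases hq : q = 0
  · simp [hq]
  by_cases hp : p = 0
  · simp [hp]
  obtain ⟨p, q, r, hrel, rfl, rfl⟩ := UniqueFactorizationMonoid.exists_reduced_factors' p q hq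
  have hr : φ r ≠ 0 := fun h =>
    left_ne_zero_of_mul hq ((map_eq_zero_iff φ hinj).mp h)
  rw [map_mul, map_mul, mul_div_mul_left _ _ hr] at hc ⊢
  have hp := right_ne_zero_of_mul hp
  have hq := right_ne_zero_of_mul hq
  have hφq : φ q ≠ 0 := fun h => hq ((map_eq_zero_iff φ hinj).mp h)
  have hder := fun p => aeval_totalDeriv D F hF f x hd1 hdi p
  have hEq : totalDeriv n (restrictDeriv D F hF) f p * q =
      p * totalDeriv n (restrictDeriv D F hF) f q := by
    apply hinj
    rw [map_mul, map_mul, hφ, hder, hder, ← hφ]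
    have h1 : φ p = φ p / φ q * φ q := (div_mul_cancel₀ _ hφq).symm
    have h2 : D (φ p) = φ p / φ q * D (φ q) := by
      conv_lhs => rw [h1, Derivation.leibniz, hc]
      simp
    rw [h2]
    field_simp
  obtain ⟨a, rfl⟩ := eq_C_of_dvd_totalDeriv hC hp
    (hrel.dvd_of_dvd_mul_right (Dvd.intro _ hEq.symm))
  obtain ⟨b, rfl⟩ := eq_C_of_dvd_totalDeriv hC hq
    (hrel.symm.dvd_of_dvd_mul_left (Dvd.intro_left _ hEq))
  rw [hφ, aeval_C, aeval_C]
  exact F.div_mem a.2 b.2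

end Extension

end IteratedIntegral

/-- In the extension `E = F(x_{i,j})` built from `f₁, …, fₙ`
satisfying condition (C), the subfield `N = F⟨x_{n,1}⟩(x_{1,1}, …, x_{1,n})` is a
no new constants extension of `F`: every constant of `N` lies in the constants of `F`. -/
theorem no_new_constants_in_N
    (E : Type) [Field E] [CharZero E] (D : Derivation ℚ E E)
    (F : Subfield E) (hF : ∀ a ∈ F, D a ∈ F)
    (n : ℕ) (f : ℕ → E) (hf : ∀ j, 1 ≤ j → j ≤ n → f j ∈ F)
    (hcondC : ∀ (c : ℕ → E) (g : E),
      (∀ j, 1 ≤ j → j ≤ n → c j ∈ F ∧ D (c j) = 0) → g ∈ F →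
      (∑ j ∈ Finset.Icc 1 n, c j * f j) = D g → ∀ j, 1 ≤ j → j ≤ n → c j = 0)
    (x : ℕ → ℕ → E)
    (hind : AlgebraicIndependent F
      (fun p : {p : ℕ × ℕ // 1 ≤ p.1 ∧ 1 ≤ p.2 ∧ p.1 + p.2 ≤ n + 1} => x p.1.1 p.1.2))
    (hgen : Subfield.closure
      (↑F ∪ {a | ∃ i j, 1 ≤ i ∧ 1 ≤ j ∧ i + j ≤ n + 1 ∧ a = x i j}) = ⊤)
    (hd1 : ∀ j, 1 ≤ j → j ≤ n → D (x 1 j) = f j)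
    (hdi : ∀ i j, 2 ≤ i → 1 ≤ j → i + j ≤ n + 1 → D (x i j) = f j * x (i - 1) (j + 1)) :
    ∀ c : E,
      c ∈ Subfield.closure
        (↑(diffAdjoin E D F {x n 1}) ∪ {a | ∃ j, 1 ≤ j ∧ j ≤ n ∧ a = x 1 j}) →
      D c = 0 → c ∈ F := by
  intro c _ hc
  have hfF : ∀ j, 1 ≤ j → j ≤ n → f (max 1 (min j n)) = f j := fun j h1 h2 => by
    rw [min_eq_left h2, max_eq_right h1]
  rcases Nat.eq_zero_or_pos n with rfl | hn
  · refine IteratedIntegral.mem_of_deriv_eq_zero D F hF (n := 0) (fun _ => 0)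
      (fun _ _ _ _ j h1 h2 => by omega) x hind hgen (fun j h1 h2 => by omega)
      (fun i j _ _ _ => by omega) hc
  let g : ℕ → F := fun j => ⟨f (max 1 (min j n)), hf _ (by omega) (by omega)⟩
  have hg : ∀ j, 1 ≤ j → j ≤ n → (g j : E) = f j := hfF
  refine IteratedIntegral.mem_of_deriv_eq_zero D F hF g (fun c a hc h j h1 h2 => ?_) x hind hgen
    (fun j h1 h2 => by rw [hd1 j h1 h2, hg j h1 h2])
    (fun i j hi hj hij => by rw [hdi i j hi hj hij, hg j hj (by omega)]) hc
  refine Subtype.ext (hcondC (fun j => c j) a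
    (fun j h1 h2 => ⟨(c j).2, congrArg Subtype.val (hc j h1 h2)⟩) a.2 ?_ j h1 h2)
  have h3 := congrArg Subtype.val h
  rw [IteratedIntegral.coe_restrictDeriv] at h3
  rw [← h3]
  push_cast
  exact Finset.sum_congr rfl fun j hj => by
    rw [hg j (Finset.mem_Icc.mp hj).1 (Finset.mem_Icc.mp hj).2]
end

section
/- Let F be a differential field of characteristic zero with field of constants C, let f₁, …, fₙ ∈ F satisfy condition (C), and let F ⊆ E be an extension of differential fields with E = F(x_{i,j} : 1 ≤ i ≤ n, 1 ≤ j ≤ n+1−i), where the x_{i,j} are algebraically independent over F and x_{1,j}′ = f_j, x_{i,j}′ = f_j · x_{i−1, j+1} for 2 ≤ i ≤ n. If x ∈ E satisfies x′ ∈ F, then there exist constants c₁, …, cₙ ∈ C and f ∈ F such that x = Σᵢ cᵢ·x_{1,i} + f. Moreover, if in addition x ∈ F⟨x_{s,t}⟩ for some pair (s,t), then cᵢ = 0 for all i ≠ s+t−1, so that x = c_{s+t−1}·x_{1,s+t−1} + f. -/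
open MvPolynomial

section LocallyNilpotent

variable {k R ι : Type*} [Field k] [CommRing R] [Algebra k R]

/-- The composite of the derivations `δ p` along a word, the head of the word acting first. -/
def wordAct (δ : ι → Derivation k R R) : List ι → R →ₗ[k] R
  | [] => LinearMap.id
  | p :: w => wordAct δ w ∘ₗ (δ p : R →ₗ[k] R)

/-- `r` is annihilated by every word of length `m` in the derivations `δ p`. -/
def KilledAt (δ : ι → Derivation k R R) (m : ℕ) (r : R) : Prop :=
  ∀ w : List ι, w.length = m → wordAct δ w r = 0

variable {δ : ι → Derivation k R R}

theorem wordAct_cons (p : ι) (w : List ι) (r : R) :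
    wordAct δ (p :: w) r = wordAct δ w (δ p r) := rfl

theorem wordAct_concat (w : List ι) (p : ι) (r : R) :
    wordAct δ (w ++ [p]) r = δ p (wordAct δ w r) := by
  induction w generalizing r with
  | nil => rfl
  | cons q w ih => exact ih _

theorem killedAt_zero {r : R} : KilledAt δ 0 r ↔ r = 0 := by
  constructor
  · intro h
    exact h [] rfl
  · rintro rfl w -
    exact map_zero _

theorem killedAt_succ {m : ℕ} {r : R} : KilledAt δ (m + 1) r ↔ ∀ p, KilledAt δ m (δ p r) := by
  constructor
  · intro h p w hw
    exact h (p :: w) (by simp [hw])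
  · rintro h (_ | ⟨p, w⟩) hw
    · simp at hw
    · exact h p w (by simpa using hw)

theorem killedAt_of_zero (m : ℕ) : KilledAt δ m (0 : R) := fun _ _ => map_zero _

theorem KilledAt.add {m : ℕ} {r s : R} (hr : KilledAt δ m r) (hs : KilledAt δ m s) :
    KilledAt δ m (r + s) := fun w hw => by rw [map_add, hr w hw, hs w hw, add_zero]

theorem KilledAt.succ {m : ℕ} {r : R} (hr : KilledAt δ m r) : KilledAt δ (m + 1) r := by
  induction m generalizing r with
  | zero =>
    rw [killedAt_zero.1 hr]
    exact killedAt_of_zero _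
  | succ m ih => exact killedAt_succ.2 fun p => ih (killedAt_succ.1 hr p)

theorem KilledAt.mono {m l : ℕ} {r : R} (hr : KilledAt δ m r) (hml : m ≤ l) :
    KilledAt δ l r := by
  induction hml with
  | refl => exact hr
  | step _ ih => exact ih.succ

theorem KilledAt.mul {m l : ℕ} {r s : R} (hr : KilledAt δ m r) (hs : KilledAt δ l s) :
    KilledAt δ (m + l) (r * s) := by
  induction m generalizing l r s with
  | zero =>
    rw [killedAt_zero.1 hr, zero_mul]
    exact killedAt_of_zero _
  | succ m ihm =>
    induction l generalizing s with
    | zero =>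
      rw [killedAt_zero.1 hs, mul_zero]
      exact killedAt_of_zero _
    | succ l ihl =>
      refine (killedAt_succ (m := m + 1 + l)).2 fun p => ?_
      rw [Derivation.leibniz, smul_eq_mul, smul_eq_mul]
      refine (ihl (killedAt_succ.1 hs p)).add ?_
      rw [mul_comm s]
      exact (ihm (killedAt_succ.1 hr p) hs).mono (by omega)

theorem map_wordAct {d : Derivation ℤ R R} (hcomm : ∀ p r, d (δ p r) = δ p (d r))
    (w : List ι) (r : R) : d (wordAct δ w r) = wordAct δ w (d r) := by
  induction w generalizing r with
  | nil => rfl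
  | cons p w ih => rw [wordAct_cons, wordAct_cons, ih, hcomm]

/-- A ring with a derivation `d` whose constants are scalars, and with a commuting family of locally
nilpotent derivations whose common kernel consists of scalars, is `d`-simple. -/
theorem ideal_eq_top_of_stable [Finite ι] {d : Derivation ℤ R R}
    (hcomm : ∀ p r, d (δ p r) = δ p (d r))
    (hker : ∀ r, (∀ p, δ p r = 0) → ∃ c, r = algebraMap k R c)
    (hnil : ∀ r, ∃ m, KilledAt δ m r)
    (hconst : ∀ r, d r = 0 → ∃ c, r = algebraMap k R c)
    (I : Ideal R) (hI : ∀ r ∈ I, d r ∈ I) (hne : I ≠ ⊥) : I = ⊤ := by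
  classical
  obtain ⟨r₀, hr₀I, hr₀⟩ := Submodule.exists_mem_ne_zero_of_ne_bot hne
  have hex : ∃ m, ∃ r ∈ I, r ≠ 0 ∧ KilledAt δ m r := by
    obtain ⟨m, hm⟩ := hnil r₀
    exact ⟨m, r₀, hr₀I, hr₀, hm⟩
  obtain ⟨m, hm⟩ : ∃ m, Nat.find hex = m + 1 := by
    refine Nat.exists_eq_succ_of_ne_zero fun h0 => ?_
    obtain ⟨r, -, hr, hk⟩ := Nat.find_spec hex
    rw [h0] at hk
    exact hr (killedAt_zero.1 hk)
  have hmin : ∀ r ∈ I, r ≠ 0 → ¬ KilledAt δ m r := fun r hrI hr hk =>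
    Nat.find_min hex (m := m) (by omega) ⟨r, hrI, hr, hk⟩
  let S : R → Set (List ι) := fun r => {w | w.length = m ∧ wordAct δ w r ≠ 0}
  have hfin : ∀ r, (S r).Finite := fun r =>
    (List.finite_length_eq ι m).subset fun w hw => hw.1
  have hex' : ∃ N, ∃ r ∈ I, r ≠ 0 ∧ KilledAt δ (m + 1) r ∧ (S r).ncard = N := by
    obtain ⟨r, hrI, hr, hk⟩ := Nat.find_spec hex
    exact ⟨_, r, hrI, hr, hm ▸ hk, rfl⟩
  obtain ⟨r, hrI, hr, hk, hN⟩ := Nat.find_spec hex'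
  obtain ⟨w₀, hw₀, hw₀r⟩ : ∃ w, w.length = m ∧ wordAct δ w r ≠ 0 := by
    by_contra! h
    exact hmin r hrI hr h
  obtain ⟨c, hc⟩ := hker (wordAct δ w₀ r) fun p => by
    rw [← wordAct_concat]
    exact hk _ (by simp [hw₀])
  have hc0 : c ≠ 0 := by
    rintro rfl
    exact hw₀r (by rw [hc, map_zero])
  have hsI : c⁻¹ • r ∈ I := I.smul_of_tower_mem _ hrI
  have hs0 : c⁻¹ • r ≠ 0 := by simpa [hc0] using hr
  have hds : d (c⁻¹ • r) = 0 := by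
    by_contra hne0
    refine Nat.find_min hex' (m := (S (d (c⁻¹ • r))).ncard) ?_
      ⟨_, hI _ hsI, hne0, fun w hw => ?_, rfl⟩
    · rw [← hN]
      refine Set.ncard_lt_ncard ⟨fun w hw => ⟨hw.1, fun h0 => hw.2 ?_⟩, fun hsub => ?_⟩ (hfin r)
      · rw [← map_wordAct hcomm, map_smul, h0, smul_zero, map_zero]
      · refine (hsub ⟨hw₀, hw₀r⟩ : w₀ ∈ S _).2 ?_
        rw [← map_wordAct hcomm, map_smul, hc, Algebra.smul_def, ← map_mul,
          inv_mul_cancel₀ hc0, map_one, Derivation.map_one_eq_zero]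
    · rw [← map_wordAct hcomm, map_smul, hk w hw, smul_zero, map_zero]
  obtain ⟨e, he⟩ := hconst _ hds
  have he0 : e ≠ 0 := by
    rintro rfl
    exact hs0 (by rw [he, map_zero])
  exact I.eq_top_of_isUnit_mem (he ▸ hsI) ((isUnit_iff_ne_zero.2 he0).map _)

end LocallyNilpotent

theorem MvPolynomial.exists_eq_C_of_pderiv_eq_zero {σ k : Type*} [Field k] [CharZero k]
    {r : MvPolynomial σ k} (h : ∀ i, pderiv i r = 0) : ∃ c, r = C c := by
  classical
  refine ⟨coeff 0 r, ?_⟩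
  ext m
  rw [coeff_C]
  split_ifs with hm
  · rw [hm]
  · obtain ⟨i, hi⟩ : ∃ i, m i ≠ 0 := by
      by_contra! h0
      exact hm (Finsupp.ext fun i => (h0 i).symm)
    have hle : Finsupp.single i 1 ≤ m := by
      rw [Finsupp.single_le_iff]
      omega
    have hcoeff := congrArg (coeff (m - Finsupp.single i 1)) (h i)
    rw [coeff_pderiv, coeff_zero, tsub_add_cancel_of_le hle] at hcoeff
    refine (mul_eq_zero.1 hcoeff).resolve_right ?_
    exact Nat.cast_add_one_ne_zero _

section IteratedIntegrals

/-- Indices of the variables `x_{i,j}`; the index `(i, j)` stands for the interval of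
letters `j, …, i + j - 1`. -/
abbrev TriangleIndex (n : ℕ) : Type := {p : ℕ × ℕ // 1 ≤ p.1 ∧ 1 ≤ p.2 ∧ p.1 + p.2 ≤ n + 1}

instance finite_triangleIndex (n : ℕ) : Finite (TriangleIndex n) := by
  refine Set.Finite.to_subtype (s := {p : ℕ × ℕ | 1 ≤ p.1 ∧ 1 ≤ p.2 ∧ p.1 + p.2 ≤ n + 1}) ?_
  refine (Set.finite_Iic (n + 1, n + 1)).subset ?_
  rintro ⟨a, b⟩ ⟨h₁, h₂, h₃⟩
  exact ⟨by dsimp only at *; omega, by dsimp only at *; omega⟩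

variable (k : Type*) [Field k] (n : ℕ)

/-- The variable `x_{i,j}`, with the conventions `x_{0,j} = 1` and `x_{i,j} = 0` outside the
range of indices. -/
noncomputable def triangleVar (i j : ℕ) : MvPolynomial (TriangleIndex n) k :=
  if i = 0 then 1 else
    if h : 1 ≤ i ∧ 1 ≤ j ∧ i + j ≤ n + 1 then X ⟨(i, j), h⟩ else 0

/-- The derivation indexed by `p` truncates an interval ending with the interval `p` by removing
`p`, and kills the other variables. -/
noncomputable def truncDeriv (p : TriangleIndex n) :
    Derivation k (MvPolynomial (TriangleIndex n) k) (MvPolynomial (TriangleIndex n) k) :=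
  mkDerivation k fun q =>
    if q.1.1 + q.1.2 = p.1.1 + p.1.2 ∧ q.1.2 ≤ p.1.2
      then triangleVar k n (p.1.2 - q.1.2) q.1.2 else 0

variable {k n}

theorem triangleVar_zero (j : ℕ) : triangleVar k n 0 j = 1 := if_pos rfl

theorem X_eq_triangleVar (p : TriangleIndex n) : X p = triangleVar k n p.1.1 p.1.2 := by
  have h := p.2
  rw [triangleVar, if_neg (by omega), dif_pos h]

theorem truncDeriv_triangleVar (p : TriangleIndex n) {i j : ℕ} (hj : 1 ≤ j)
    (hij : i + j ≤ n + 1) :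
    truncDeriv k n p (triangleVar k n i j) =
      if i + j = p.1.1 + p.1.2 ∧ j ≤ p.1.2 then triangleVar k n (p.1.2 - j) j else 0 := by
  have hp := p.2
  rcases Nat.eq_zero_or_pos i with rfl | hi
  · rw [triangleVar_zero, Derivation.map_one_eq_zero, if_neg (by omega)]
  · rw [← X_eq_triangleVar ⟨(i, j), hi, hj, hij⟩, truncDeriv, mkDerivation_X]

theorem killedAt_triangleVar {i j : ℕ} (hj : 1 ≤ j) (hij : i + j ≤ n + 1) :
    KilledAt (truncDeriv k n) (i + 1) (triangleVar k n i j) := by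
  induction i using Nat.strong_induction_on with
  | _ i ih =>
    refine killedAt_succ.2 fun p => ?_
    have hp := p.2
    rw [truncDeriv_triangleVar p hj hij]
    split_ifs with h
    · exact (ih (p.1.2 - j) (by omega) (by omega)).mono (by omega)
    · exact killedAt_of_zero _

theorem exists_killedAt_truncDeriv (r : MvPolynomial (TriangleIndex n) k) :
    ∃ m, KilledAt (truncDeriv k n) m r := by
  induction r using MvPolynomial.induction_on with
  | C a =>
    refine ⟨1, killedAt_succ.2 fun p => ?_⟩
    rw [← algebraMap_eq, Derivation.map_algebraMap]
    exact killedAt_of_zero _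
  | add r s hr hs =>
    obtain ⟨m, hm⟩ := hr
    obtain ⟨l, hl⟩ := hs
    exact ⟨max m l, (hm.mono (le_max_left _ _)).add (hl.mono (le_max_right _ _))⟩
  | mul_X r p hr =>
    obtain ⟨m, hm⟩ := hr
    rw [X_eq_triangleVar]
    exact ⟨_, hm.mul (killedAt_triangleVar p.2.2.1 p.2.2.2)⟩

theorem truncDeriv_eq_sum [Fintype (TriangleIndex n)] (p : TriangleIndex n)
    (r : MvPolynomial (TriangleIndex n) k) :
    truncDeriv k n p r = ∑ q, truncDeriv k n p (X q) * pderiv q r := by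
  classical
  have happ : ∀ s, (∑ q, truncDeriv k n p (X q) • pderiv q :
      Derivation k (MvPolynomial (TriangleIndex n) k) (MvPolynomial (TriangleIndex n) k)) s =
      ∑ q, truncDeriv k n p (X q) * pderiv q s := fun s => by
    rw [← Derivation.coeFnAddMonoidHom_apply, map_sum, Finset.sum_apply]
    rfl
  rw [← happ]
  congr 1
  refine derivation_ext fun i => ?_
  rw [happ, Finset.sum_eq_single i]
  · rw [pderiv_X_self, mul_one]
  · intro q _ hq
    rw [pderiv_X_of_ne hq.symm, mul_zero]
  · simp

theorem exists_eq_C_of_truncDeriv_eq_zero [CharZero k] {r : MvPolynomial (TriangleIndex n) k}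
    (h : ∀ p, truncDeriv k n p r = 0) : ∃ c, r = C c := by
  classical
  have := Fintype.ofFinite (TriangleIndex n)
  suffices H : ∀ j, ∀ p : TriangleIndex n, p.1.2 = j → pderiv p r = 0 from
    exists_eq_C_of_pderiv_eq_zero fun p => H _ p rfl
  intro j
  induction j using Nat.strong_induction_on with
  | _ j ih =>
    intro p hpj
    have hp := h p
    rw [truncDeriv_eq_sum, Finset.sum_eq_single p] at hp
    · rwa [X_eq_triangleVar, truncDeriv_triangleVar p p.2.2.1 p.2.2.2, if_pos ⟨rfl, le_rfl⟩,
        Nat.sub_self, triangleVar_zero, one_mul] at hp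
    · intro q _ hqp
      rw [X_eq_triangleVar, truncDeriv_triangleVar p q.2.2.1 q.2.2.2]
      split_ifs with hq
      · have hne : q.1.2 ≠ p.1.2 := fun he =>
          hqp (Subtype.ext (Prod.ext (by omega) he))
        rw [ih q.1.2 (by omega) q rfl, mul_zero]
      · exact zero_mul _
    · simp

theorem lie_truncDeriv (p q s : TriangleIndex n) (hq : q.1.1 = 1)
    (hpq : p.1.1 + p.1.2 = q.1.2) (hs : s.1 = (p.1.1 + 1, p.1.2)) :
    ⁅truncDeriv k n p, truncDeriv k n q⁆ = truncDeriv k n s := by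
  have hp := p.2
  have hs1 : s.1.1 = p.1.1 + 1 := by rw [hs]
  have hs2 : s.1.2 = p.1.2 := by rw [hs]
  refine derivation_ext fun t => ?_
  have ht := t.2
  rw [Derivation.commutator_apply, X_eq_triangleVar, truncDeriv_triangleVar q ht.2.1 ht.2.2,
    truncDeriv_triangleVar p ht.2.1 ht.2.2, truncDeriv_triangleVar s ht.2.1 ht.2.2, hs1, hs2]
  have hz : truncDeriv k n q (if t.1.1 + t.1.2 = p.1.1 + p.1.2 ∧ t.1.2 ≤ p.1.2
      then triangleVar k n (p.1.2 - t.1.2) t.1.2 else 0) = 0 := by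
    split_ifs with h
    · rw [truncDeriv_triangleVar q ht.2.1 (by omega), if_neg (by omega)]
    · exact map_zero _
  rw [hz, sub_zero]
  by_cases h : t.1.1 + t.1.2 = q.1.1 + q.1.2 ∧ t.1.2 ≤ q.1.2
  · rw [if_pos h, truncDeriv_triangleVar p ht.2.1 (by omega)]
    exact if_congr (by omega) rfl rfl
  · rw [if_neg h, map_zero, if_neg (by omega)]

theorem truncDeriv_C (p : TriangleIndex n) (a : k) : truncDeriv k n p (C a) = 0 :=
  Derivation.map_algebraMap _ a

theorem truncDeriv_linear (p : TriangleIndex n) (c : ℕ → k) (g : k) :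
    truncDeriv k n p (∑ i ∈ Finset.Icc 1 n, C (c i) * triangleVar k n 1 i + C g) =
      if p.1.1 = 1 then C (c p.1.2) else 0 := by
  have hp := p.2
  rw [map_add, truncDeriv_C, add_zero, map_sum]
  have hterm : ∀ i ∈ Finset.Icc 1 n, truncDeriv k n p (C (c i) * triangleVar k n 1 i) =
      if i = p.1.2 then (if p.1.1 = 1 then C (c p.1.2) else 0) else 0 := by
    intro i hi
    rw [Finset.mem_Icc] at hi
    rw [Derivation.leibniz, truncDeriv_C, smul_zero, add_zero, smul_eq_mul,
      truncDeriv_triangleVar p hi.1 (by omega)]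
    by_cases h : i = p.1.2
    · by_cases h1 : p.1.1 = 1
      · rw [if_pos (by omega), if_pos h, if_pos h1, h, Nat.sub_self, triangleVar_zero, mul_one]
      · rw [if_neg (by omega), if_pos h, if_neg h1, mul_zero]
    · rw [if_neg (by omega), if_neg h, mul_zero]
  rw [Finset.sum_congr rfl hterm, Finset.sum_ite_eq', if_pos (Finset.mem_Icc.2 (by omega))]

theorem exists_linear_of_truncDeriv_eq_C [CharZero k] {r : MvPolynomial (TriangleIndex n) k}
    {c : TriangleIndex n → k} (h : ∀ p, truncDeriv k n p r = C (c p)) :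
    ∃ (b : ℕ → k) (g : k),
      (∀ p : TriangleIndex n, p.1.1 = 1 → b p.1.2 = c p) ∧
      r = ∑ i ∈ Finset.Icc 1 n, C (b i) * triangleVar k n 1 i + C g := by
  let b : ℕ → k := fun j => if hj : 1 ≤ 1 ∧ 1 ≤ j ∧ 1 + j ≤ n + 1 then c ⟨(1, j), hj⟩ else 0
  have hb : ∀ p : TriangleIndex n, p.1.1 = 1 → b p.1.2 = c p := by
    rintro ⟨⟨i, j⟩, hp⟩ rfl
    exact dif_pos hp
  obtain ⟨g, hg⟩ := exists_eq_C_of_truncDeriv_eq_zero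
    (r := r - (∑ i ∈ Finset.Icc 1 n, C (b i) * triangleVar k n 1 i + C 0)) fun p => by
      rw [map_sub, truncDeriv_linear, h]
      split_ifs with hp1
      · rw [hb p hp1, sub_self]
      · have hp := p.2
        rw [sub_zero, ← h, ← lie_truncDeriv ⟨(p.1.1 - 1, p.1.2), by dsimp only; omega⟩
          ⟨(1, p.1.1 + p.1.2 - 1), by dsimp only; omega⟩ p rfl (by dsimp only; omega)
          (Prod.ext (by dsimp only; omega) rfl), Derivation.commutator_apply, h, h,
          truncDeriv_C, truncDeriv_C, sub_zero]
  refine ⟨b, g, hb, ?_⟩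
  rw [← hg, C_0]
  ring

section Derivation

variable {f : ℕ → k} {δ₀ : k → k}
  {d : Derivation ℤ (MvPolynomial (TriangleIndex n) k) (MvPolynomial (TriangleIndex n) k)}

theorem truncDeriv_comm (hdC : ∀ a, d (C a) = C (δ₀ a))
    (hdX : ∀ i j, 1 ≤ i → 1 ≤ j → i + j ≤ n + 1 →
      d (triangleVar k n i j) = C (f j) * triangleVar k n (i - 1) (j + 1))
    (p : TriangleIndex n) (r : MvPolynomial (TriangleIndex n) k) :
    d (truncDeriv k n p r) = truncDeriv k n p (d r) := by
  induction r using MvPolynomial.induction_on with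
  | C a => rw [truncDeriv_C, map_zero, hdC, truncDeriv_C]
  | add r s hr hs => simp only [map_add, hr, hs]
  | mul_X r q hr =>
    have hX : d (truncDeriv k n p (X q)) = truncDeriv k n p (d (X q)) := by
      have hp := p.2
      have hq := q.2
      rw [X_eq_triangleVar, hdX _ _ hq.1 hq.2.1 hq.2.2, Derivation.leibniz, truncDeriv_C,
        smul_zero, add_zero, smul_eq_mul, truncDeriv_triangleVar p hq.2.1 hq.2.2,
        truncDeriv_triangleVar p (by omega) (by omega)]
      by_cases h : q.1.1 + q.1.2 = p.1.1 + p.1.2 ∧ q.1.2 ≤ p.1.2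
      · rw [if_pos h]
        rcases h.2.eq_or_lt with he | hlt
        · rw [he, Nat.sub_self, triangleVar_zero, Derivation.map_one_eq_zero, if_neg (by omega),
            mul_zero]
        · rw [if_pos (by omega), hdX _ _ (by omega) hq.2.1 (by omega), Nat.sub_sub]
      · rw [if_neg h, map_zero, if_neg (by omega), mul_zero]
    simp only [Derivation.leibniz, smul_eq_mul, map_add, hr, hX]
    ring

theorem map_linear (hdC : ∀ a, d (C a) = C (δ₀ a))
    (hdX : ∀ i j, 1 ≤ i → 1 ≤ j → i + j ≤ n + 1 →
      d (triangleVar k n i j) = C (f j) * triangleVar k n (i - 1) (j + 1))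
    {c : ℕ → k} (hc : ∀ i, 1 ≤ i → i ≤ n → δ₀ (c i) = 0) (g : k) :
    d (∑ i ∈ Finset.Icc 1 n, C (c i) * triangleVar k n 1 i + C g) =
      C (∑ i ∈ Finset.Icc 1 n, c i * f i + δ₀ g) := by
  rw [map_add, map_sum, hdC, C_add, map_sum]
  congr 1
  refine Finset.sum_congr rfl fun i hi => ?_
  rw [Finset.mem_Icc] at hi
  rw [Derivation.leibniz, hdC, hc i hi.1 hi.2, hdX 1 i le_rfl hi.1 (by omega), Nat.sub_self,
    triangleVar_zero, C_0, smul_zero, add_zero, smul_eq_mul, mul_one, C_mul]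

/-- Under condition (C), the polynomial constants lie in the base field. -/
theorem exists_eq_C_of_derivation_eq_zero [CharZero k] (hdC : ∀ a, d (C a) = C (δ₀ a))
    (hdX : ∀ i j, 1 ≤ i → 1 ≤ j → i + j ≤ n + 1 →
      d (triangleVar k n i j) = C (f j) * triangleVar k n (i - 1) (j + 1))
    (hcond : ∀ (c : ℕ → k) (g : k), (∀ j, 1 ≤ j → j ≤ n → δ₀ (c j) = 0) →
      ∑ j ∈ Finset.Icc 1 n, c j * f j + δ₀ g = 0 → ∀ j, 1 ≤ j → j ≤ n → c j = 0)
    {r : MvPolynomial (TriangleIndex n) k} (hr : d r = 0) : ∃ c, r = C c := by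
  obtain ⟨m, hm⟩ := exists_killedAt_truncDeriv r
  induction m generalizing r with
  | zero => exact ⟨0, by rw [killedAt_zero.1 hm, C_0]⟩
  | succ m ih =>
    have hdr : ∀ p, d (truncDeriv k n p r) = 0 := fun p => by
      rw [truncDeriv_comm hdC hdX, hr, map_zero]
    choose c hc using fun p => ih (hdr p) (killedAt_succ.1 hm p)
    obtain ⟨b, g, hb, rfl⟩ := exists_linear_of_truncDeriv_eq_C hc
    have hb0 : ∀ j, 1 ≤ j → j ≤ n → δ₀ (b j) = 0 := fun j h₁ h₂ => by
      have h := hdr ⟨(1, j), by dsimp only; omega⟩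
      rw [truncDeriv_linear, if_pos rfl, hdC] at h
      exact C_eq_zero.1 h
    rw [map_linear hdC hdX hb0, C_eq_zero] at hr
    have hz := hcond b g hb0 hr
    refine ⟨g, ?_⟩
    rw [Finset.sum_eq_zero, zero_add]
    intro i hi
    rw [Finset.mem_Icc] at hi
    rw [hz i hi.1 hi.2, C_0, zero_mul]

/-- Polynomials whose derivative is a scalar are linear in the `x_{1,i}`, with constant
coefficients. -/
theorem exists_linear_of_derivation_eq_C [CharZero k] (hdC : ∀ a, d (C a) = C (δ₀ a))
    (hdX : ∀ i j, 1 ≤ i → 1 ≤ j → i + j ≤ n + 1 →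
      d (triangleVar k n i j) = C (f j) * triangleVar k n (i - 1) (j + 1))
    (hcond : ∀ (c : ℕ → k) (g : k), (∀ j, 1 ≤ j → j ≤ n → δ₀ (c j) = 0) →
      ∑ j ∈ Finset.Icc 1 n, c j * f j + δ₀ g = 0 → ∀ j, 1 ≤ j → j ≤ n → c j = 0)
    {r : MvPolynomial (TriangleIndex n) k} {a : k} (hr : d r = C a) :
    ∃ (c : ℕ → k) (g : k), (∀ i, 1 ≤ i → i ≤ n → δ₀ (c i) = 0) ∧
      r = ∑ i ∈ Finset.Icc 1 n, C (c i) * triangleVar k n 1 i + C g := by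
  have hdr : ∀ p, d (truncDeriv k n p r) = 0 := fun p => by
    rw [truncDeriv_comm hdC hdX, hr, truncDeriv_C]
  choose c hc using fun p => exists_eq_C_of_derivation_eq_zero hdC hdX hcond (hdr p)
  obtain ⟨b, g, hb, hrb⟩ := exists_linear_of_truncDeriv_eq_C hc
  refine ⟨b, g, fun j h₁ h₂ => ?_, hrb⟩
  have h := hdr ⟨(1, j), by dsimp only; omega⟩
  rw [hrb, truncDeriv_linear, if_pos rfl, hdC] at h
  exact C_eq_zero.1 h

end Derivation

end IteratedIntegrals

theorem Subfield.derivation_mem_closure {E : Type*} [Field E] [CharZero E] (D : Derivation ℚ E E)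
    {s : Set E} (hs : ∀ a ∈ s, D a ∈ Subfield.closure s) {a : E} (ha : a ∈ Subfield.closure s) :
    D a ∈ Subfield.closure s := by
  induction ha using Subfield.closure_induction with
  | mem a ha => exact hs a ha
  | one => simp
  | add a b _ _ iha ihb =>
    rw [map_add]
    exact add_mem iha ihb
  | neg a _ iha =>
    rw [map_neg]
    exact neg_mem iha
  | inv a ha iha =>
    rw [Derivation.leibniz_inv, smul_eq_mul]
    exact mul_mem (neg_mem (pow_mem (inv_mem ha) 2)) iha
  | mul a b ha hb iha ihb =>
    rw [Derivation.leibniz, smul_eq_mul, smul_eq_mul]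
    exact add_mem (mul_mem ha ihb) (mul_mem hb iha)

/-- A derivation preserving the image of an injective ring homomorphism restricts to its source. -/
theorem exists_derivation_of_injective {R E : Type*} [CommRing R] [Field E] [CharZero E]
    (D : Derivation ℚ E E) (φ : R →+* E) (hφ : Function.Injective φ)
    (h : ∀ r, ∃ s, φ s = D (φ r)) : ∃ d : Derivation ℤ R R, ∀ r, φ (d r) = D (φ r) := by
  choose d hd using h
  let dAdd : R →+ R :=
    { toFun := d
      map_zero' := hφ (by simp [hd])
      map_add' := fun r s => hφ (by simp [hd]) }
  exact ⟨Derivation.mk' dAdd.toIntLinearMap fun r s => hφ (by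
    change φ (d (r * s)) = φ (r * d s + s * d r)
    simp [hd]), hd⟩

/-- In the extension `E = F(x_{i,j})` built from `f₁, …, fₙ`
satisfying condition (C), every `x ∈ E` with `x′ ∈ F` has the form
`x = Σ cᵢ·x_{1,i} + f` with the `cᵢ` constants of `F` and `f ∈ F`; moreover if in
addition `x ∈ F⟨x_{s,t}⟩` then `cᵢ = 0` for all `i ≠ s + t − 1`, so
`x = c_{s+t−1}·x_{1,s+t−1} + f`. -/
theorem antiderivatives_in_E
    (E : Type) [Field E] [CharZero E] (D : Derivation ℚ E E)
    (F : Subfield E) (hF : ∀ a ∈ F, D a ∈ F)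
    (n : ℕ) (f : ℕ → E) (hf : ∀ j, 1 ≤ j → j ≤ n → f j ∈ F)
    (hcondC : ∀ (c : ℕ → E) (g : E),
      (∀ j, 1 ≤ j → j ≤ n → c j ∈ F ∧ D (c j) = 0) → g ∈ F →
      (∑ j ∈ Finset.Icc 1 n, c j * f j) = D g → ∀ j, 1 ≤ j → j ≤ n → c j = 0)
    (x : ℕ → ℕ → E)
    (hind : AlgebraicIndependent F
      (fun p : {p : ℕ × ℕ // 1 ≤ p.1 ∧ 1 ≤ p.2 ∧ p.1 + p.2 ≤ n + 1} => x p.1.1 p.1.2))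
    (hgen : Subfield.closure
      (↑F ∪ {a | ∃ i j, 1 ≤ i ∧ 1 ≤ j ∧ i + j ≤ n + 1 ∧ a = x i j}) = ⊤)
    (hd1 : ∀ j, 1 ≤ j → j ≤ n → D (x 1 j) = f j)
    (hdi : ∀ i j, 2 ≤ i → 1 ≤ j → i + j ≤ n + 1 → D (x i j) = f j * x (i - 1) (j + 1)) :
    ∀ ξ : E, D ξ ∈ F →
      ∃ (c : ℕ → E) (g : E),
        (∀ i, 1 ≤ i → i ≤ n → c i ∈ F ∧ D (c i) = 0) ∧ g ∈ F ∧
        ξ = (∑ i ∈ Finset.Icc 1 n, c i * x 1 i) + g ∧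
        ∀ s t, 1 ≤ s → 1 ≤ t → s + t ≤ n + 1 → ξ ∈ diffAdjoin E D F {x s t} →
          (∀ i, 1 ≤ i → i ≤ n → i ≠ s + t - 1 → c i = 0) ∧
          ξ = c (s + t - 1) * x 1 (s + t - 1) + g := by
  classical
  intro ξ hξ
  let fF : ℕ → F := fun j => if h : 1 ≤ j ∧ j ≤ n then ⟨f j, hf j h.1 h.2⟩ else 0
  have hfF : ∀ j, 1 ≤ j → j ≤ n → (fF j : E) = f j := fun j h₁ h₂ => by
    simp only [fF, dif_pos (And.intro h₁ h₂)]
  let DF : F → F := fun a => ⟨D a, hF a a.2⟩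
  let φ : MvPolynomial (TriangleIndex n) F →ₐ[F] E := aeval fun p => x p.1.1 p.1.2
  have hφinj : Function.Injective φ := hind
  have hφC : ∀ a : F, φ (C a) = a := fun a => φ.commutes a
  have hφx : ∀ i j, 1 ≤ i → 1 ≤ j → i + j ≤ n + 1 → φ (triangleVar F n i j) = x i j :=
    fun i j h₁ h₂ h₃ => by
      rw [← X_eq_triangleVar ⟨(i, j), h₁, h₂, h₃⟩]
      exact aeval_X _ _
  have hDx : ∀ i j, 1 ≤ i → 1 ≤ j → i + j ≤ n + 1 →
      φ (C (fF j) * triangleVar F n (i - 1) (j + 1)) = D (x i j) := by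
    intro i j h₁ h₂ h₃
    rw [map_mul, hφC, hfF j h₂ (by omega)]
    rcases h₁.eq_or_lt with rfl | hi
    · rw [Nat.sub_self, triangleVar_zero, map_one, mul_one, hd1 j h₂ (by omega)]
    · rw [hφx _ _ (by omega) (by omega) (by omega), hdi i j hi h₂ h₃]
  obtain ⟨d, hd⟩ := exists_derivation_of_injective D φ.toRingHom hφinj fun r => by
    induction r using MvPolynomial.induction_on with
    | C a => exact ⟨C (DF a), by simp only [AlgHom.toRingHom_eq_coe, RingHom.coe_coe, hφC]; rfl⟩
    | add r s hr hs =>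
      obtain ⟨r', hr'⟩ := hr
      obtain ⟨s', hs'⟩ := hs
      exact ⟨r' + s', by rw [map_add, map_add, map_add, hr', hs']⟩
    | mul_X r p hr =>
      obtain ⟨r', hr'⟩ := hr
      refine ⟨r * (C (fF p.1.2) * triangleVar F n (p.1.1 - 1) (p.1.2 + 1)) + X p * r', ?_⟩
      rw [map_add, map_mul, map_mul _ r, map_mul _ (X p), hr', Derivation.leibniz, smul_eq_mul,
        smul_eq_mul]
      simp only [AlgHom.toRingHom_eq_coe, RingHom.coe_coe]
      rw [hDx _ _ p.2.1 p.2.2.1 p.2.2.2, X_eq_triangleVar, hφx _ _ p.2.1 p.2.2.1 p.2.2.2]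
  simp only [AlgHom.toRingHom_eq_coe, RingHom.coe_coe] at hd
  have hdC : ∀ a, d (C a) = C (DF a) := fun a => hφinj (by rw [hd, hφC, hφC])
  have hdX : ∀ i j, 1 ≤ i → 1 ≤ j → i + j ≤ n + 1 →
      d (triangleVar F n i j) = C (fF j) * triangleVar F n (i - 1) (j + 1) :=
    fun i j h₁ h₂ h₃ => hφinj (by rw [hd, hφx i j h₁ h₂ h₃, hDx i j h₁ h₂ h₃])
  have hcond : ∀ (c : ℕ → F) (g : F), (∀ j, 1 ≤ j → j ≤ n → DF (c j) = 0) →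
      ∑ j ∈ Finset.Icc 1 n, c j * fF j + DF g = 0 → ∀ j, 1 ≤ j → j ≤ n → c j = 0 := by
    intro c g hc h j h₁ h₂
    refine Subtype.ext (hcondC (fun j => c j) (-g) (fun j h₁ h₂ =>
      ⟨(c j).2, congrArg Subtype.val (hc j h₁ h₂)⟩) (neg_mem g.2) ?_ j h₁ h₂)
    have h' := congrArg Subtype.val h
    push_cast at h'
    rw [map_neg, eq_neg_iff_add_eq_zero, ← h']
    congr 1
    refine Finset.sum_congr rfl fun i hi => ?_
    rw [Finset.mem_Icc] at hi
    rw [hfF i hi.1 hi.2]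
  have hfrac : ∃ P Q, Q ≠ 0 ∧ φ Q * ξ = φ P := by
    have hmem : ξ ∈ Subfield.closure
        (↑F ∪ {a | ∃ i j, 1 ≤ i ∧ 1 ≤ j ∧ i + j ≤ n + 1 ∧ a = x i j}) := hgen ▸ Subfield.mem_top ξ
    obtain ⟨a, ha, b, hb, hab⟩ := Subfield.mem_closure_iff.1 hmem
    have hle : Subring.closure (↑F ∪ {a | ∃ i j, 1 ≤ i ∧ 1 ≤ j ∧ i + j ≤ n + 1 ∧ a = x i j}) ≤
        φ.toRingHom.range := by
      refine Subring.closure_le.2 ?_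
      rintro a (ha | ⟨i, j, h₁, h₂, h₃, rfl⟩)
      · exact ⟨C ⟨a, ha⟩, hφC _⟩
      · exact ⟨_, hφx i j h₁ h₂ h₃⟩
    obtain ⟨P, rfl⟩ := hle ha
    obtain ⟨Q, rfl⟩ := hle hb
    by_cases hQ : Q = 0
    · refine ⟨0, 1, one_ne_zero, ?_⟩
      rw [← hab, hQ, map_zero, map_zero, div_zero, mul_zero]
    · refine ⟨P, Q, hQ, ?_⟩
      rw [← hab]
      exact mul_div_cancel₀ _ ((map_ne_zero_iff _ hφinj).2 hQ)
  obtain ⟨r, rfl⟩ : ∃ r, φ r = ξ := by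
    let I : Ideal (MvPolynomial (TriangleIndex n) F) :=
      { carrier := {Q | ∃ P, φ Q * ξ = φ P}
        zero_mem' := ⟨0, by simp⟩
        add_mem' := by
          rintro Q Q' ⟨P, hP⟩ ⟨P', hP'⟩
          exact ⟨P + P', by rw [map_add, map_add, add_mul, hP, hP']⟩
        smul_mem' := by
          rintro S Q ⟨P, hP⟩
          exact ⟨S * P, by rw [smul_eq_mul, map_mul, map_mul, mul_assoc, hP]⟩ }
    have hItop : I = ⊤ := by
      refine ideal_eq_top_of_stable (δ := truncDeriv F n) (truncDeriv_comm hdC hdX)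
        (fun r hr => exists_eq_C_of_truncDeriv_eq_zero hr) exists_killedAt_truncDeriv
        (fun r hr => exists_eq_C_of_derivation_eq_zero hdC hdX hcond hr) I ?_ ?_
      · rintro Q ⟨P, hP⟩
        refine ⟨d P - Q * C ⟨D ξ, hξ⟩, ?_⟩
        rw [map_sub, map_mul, hφC, hd, hd, ← hP, Derivation.leibniz, smul_eq_mul, smul_eq_mul]
        ring
      · obtain ⟨P, Q, hQ, hPQ⟩ := hfrac
        exact (Submodule.ne_bot_iff I).2 ⟨Q, ⟨P, hPQ⟩, hQ⟩
    obtain ⟨P, hP⟩ : (1 : MvPolynomial (TriangleIndex n) F) ∈ I := hItop ▸ Submodule.mem_top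
    exact ⟨P, by rw [← hP, map_one, one_mul]⟩
  have hr : d r = C ⟨D (φ r), hξ⟩ := hφinj (by rw [hd, hφC])
  obtain ⟨c, g, hc, hrc⟩ := exists_linear_of_derivation_eq_C hdC hdX hcond hr
  have hsum : φ r = (∑ i ∈ Finset.Icc 1 n, (c i : E) * x 1 i) + g := by
    rw [hrc, map_add, map_sum, hφC]
    congr 1
    refine Finset.sum_congr rfl fun i hi => ?_
    rw [Finset.mem_Icc] at hi
    rw [map_mul, hφC, hφx 1 i le_rfl hi.1 (by omega)]
  refine ⟨fun i => c i, g, fun i h₁ h₂ => ⟨(c i).2, congrArg Subtype.val (hc i h₁ h₂)⟩, g.2,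
    hsum, ?_⟩
  intro s t hs ht hst hmem
  have hzero : ∀ i, 1 ≤ i → i ≤ n → i ≠ s + t - 1 → (c i : E) = 0 := by
    intro i h₁ h₂ hi
    let T : Set E := ↑F ∪ {a | ∃ i j, 1 ≤ i ∧ 1 ≤ j ∧ i + j = s + t ∧ a = x i j}
    have hFT : ∀ a ∈ F, a ∈ Subfield.closure T := fun a ha => Subfield.subset_closure (Or.inl ha)
    have hxT : ∀ i j, 1 ≤ i → 1 ≤ j → i + j = s + t → x i j ∈ Subfield.closure T :=
      fun i j h₁ h₂ h₃ => Subfield.subset_closure (Or.inr ⟨i, j, h₁, h₂, h₃, rfl⟩)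
    have hle : diffAdjoin E D F {x s t} ≤ Subfield.closure T := by
      refine sInf_le ⟨hFT, by simpa using hxT s t hs ht rfl, fun a ha =>
        Subfield.derivation_mem_closure D ?_ ha⟩
      rintro a (ha | ⟨i, j, h₁, h₂, h₃, rfl⟩)
      · exact hFT _ (hF a ha)
      · have hfj := hFT _ (hf j h₂ (by omega))
        rcases h₁.eq_or_lt with rfl | hi
        · rwa [hd1 j h₂ (by omega)]
        · rw [hdi i j hi h₂ (by omega)]
          exact mul_mem hfj (hxT _ _ (by omega) (by omega) (by omega))
    let p : TriangleIndex n := ⟨(1, i), le_rfl, h₁, by dsimp only; omega⟩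
    have hker : ∀ a ∈ Subring.closure T, ∃ P, φ P = a ∧ truncDeriv F n p P = 0 := by
      intro a ha
      induction ha using Subring.closure_induction with
      | mem a ha =>
        rcases ha with ha | ⟨i', j, h₁', h₂', h₃', rfl⟩
        · exact ⟨C ⟨a, ha⟩, hφC _, truncDeriv_C _ _⟩
        · refine ⟨_, hφx i' j h₁' h₂' (by omega), ?_⟩
          rw [truncDeriv_triangleVar p h₂' (by omega), if_neg]
          dsimp only [p]
          omega
      | zero => exact ⟨0, map_zero _, map_zero _⟩
      | one => exact ⟨1, map_one _, Derivation.map_one_eq_zero _⟩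
      | add a b _ _ iha ihb =>
        obtain ⟨P, rfl, hP⟩ := iha
        obtain ⟨Q, rfl, hQ⟩ := ihb
        exact ⟨P + Q, map_add _ _ _, by rw [map_add, hP, hQ, add_zero]⟩
      | neg a _ iha =>
        obtain ⟨P, rfl, hP⟩ := iha
        exact ⟨-P, map_neg _ _, by rw [map_neg, hP, neg_zero]⟩
      | mul a b _ _ iha ihb =>
        obtain ⟨P, rfl, hP⟩ := iha
        obtain ⟨Q, rfl, hQ⟩ := ihb
        exact ⟨P * Q, map_mul _ _ _, by
          rw [Derivation.leibniz, hP, hQ, smul_zero, smul_zero, add_zero]⟩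
    obtain ⟨a, ha, b, hb, hab⟩ := Subfield.mem_closure_iff.1 (hle hmem)
    obtain ⟨P, rfl, hP⟩ := hker a ha
    obtain ⟨Q, rfl, hQ⟩ := hker b hb
    have hrp : truncDeriv F n p r = C (c i) := by
      rw [hrc, truncDeriv_linear, if_pos rfl]
    suffices h0 : truncDeriv F n p r = 0 by
      rw [hrp, C_eq_zero] at h0
      rw [h0, ZeroMemClass.coe_zero]
    by_cases hQ0 : Q = 0
    · rw [hQ0, map_zero, div_zero] at hab
      rw [hφinj (hab.symm.trans (map_zero φ).symm), map_zero]
    · have hQr : Q * r = P := hφinj (by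
        rw [map_mul, ← hab]
        exact mul_div_cancel₀ _ ((map_ne_zero_iff _ hφinj).2 hQ0))
      have h := congrArg (truncDeriv F n p) hQr
      rw [hP, Derivation.leibniz, hQ, smul_zero, add_zero, smul_eq_mul] at h
      exact (mul_eq_zero.1 h).resolve_left hQ0
  refine ⟨hzero, ?_⟩
  rw [hsum, Finset.sum_eq_single (s + t - 1)]
  · intro i hi hne
    rw [Finset.mem_Icc] at hi
    rw [hzero i hi.1 hi.2 hne, zero_mul]
  · intro h
    exact absurd (Finset.mem_Icc.2 (by omega)) h
end

section
/- Let F be a differential field of characteristic zero with field of constants C, let f₁, …, fₙ ∈ F satisfy condition (C), and let F ⊆ E be an extension of differential fields with E = F(x_{i,j} : 1 ≤ i ≤ n, 1 ≤ j ≤ n+1−i), where the x_{i,j} are algebraically independent over F and x_{1,j}′ = f_j, x_{i,j}′ = f_j · x_{i−1, j+1} for 2 ≤ i ≤ n. Let R = F[x_{i,j} : 1 ≤ i ≤ n, 1 ≤ j ≤ n+1−i] be the F-subalgebra of E generated by all x_{i,j}; it is closed under the derivation. Then R is a simple differential ring: every ideal I of R closed under the derivation satisfies I = {0} or I = R. 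-/
open MvPolynomial

section CoefficientDerivation

variable {σ K : Type*} [Field K] [CharZero K]

/-- The map on polynomials applying a derivation of the ground field to every coefficient. -/
noncomputable def coeffDeriv (d : Derivation ℚ K K) (p : MvPolynomial σ K) : MvPolynomial σ K :=
  ∑ m ∈ p.support, monomial m (d (coeff m p))

variable (d : Derivation ℚ K K)

theorem coeff_coeffDeriv (p : MvPolynomial σ K) (m : σ →₀ ℕ) :
    coeff m (coeffDeriv d p) = d (coeff m p) := by
  classical
  simp only [coeffDeriv, coeff_sum, coeff_monomial, Finset.sum_ite_eq', mem_support_iff]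
  split_ifs with h
  · rfl
  · rw [not_not.1 h, map_zero]

theorem coeffDeriv_add (p q : MvPolynomial σ K) :
    coeffDeriv d (p + q) = coeffDeriv d p + coeffDeriv d q := by
  ext m
  simp [coeff_coeffDeriv]

theorem coeffDeriv_zero : coeffDeriv d (0 : MvPolynomial σ K) = 0 := by
  ext m
  simp [coeff_coeffDeriv]

theorem coeffDeriv_sum {ι : Type*} (s : Finset ι) (p : ι → MvPolynomial σ K) :
    coeffDeriv d (∑ i ∈ s, p i) = ∑ i ∈ s, coeffDeriv d (p i) := by
  ext m
  simp [coeff_coeffDeriv, coeff_sum]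

theorem coeffDeriv_C (a : K) : coeffDeriv d (C a : MvPolynomial σ K) = C (d a) := by
  classical
  ext m
  simp only [coeff_coeffDeriv, coeff_C]
  split_ifs <;> simp

theorem coeffDeriv_mul_X (p : MvPolynomial σ K) (i : σ) :
    coeffDeriv d (p * X i) = coeffDeriv d p * X i := by
  classical
  ext m
  simp only [coeff_coeffDeriv, coeff_mul_X']
  split_ifs <;> simp

theorem coeffDeriv_pderiv (p : MvPolynomial σ K) (i : σ) :
    coeffDeriv d (pderiv i p) = pderiv i (coeffDeriv d p) := by
  ext m
  simp [coeff_coeffDeriv, coeff_pderiv, Derivation.leibniz, mul_comm]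

theorem weightedHomogeneousComponent_coeffDeriv (w : σ → ℕ) (k : ℕ) (p : MvPolynomial σ K) :
    weightedHomogeneousComponent w k (coeffDeriv d p) =
      coeffDeriv d (weightedHomogeneousComponent w k p) := by
  classical
  ext m
  simp only [coeff_weightedHomogeneousComponent, coeff_coeffDeriv]
  split_ifs <;> simp

theorem card_support_coeffDeriv_lt {p : MvPolynomial σ K} {m : σ →₀ ℕ} (hm : coeff m p = 1) :
    (coeffDeriv d p).support.card < p.support.card := by
  apply Finset.card_lt_card
  refine Finset.ssubset_iff_subset_ne.2 ⟨fun l hl => ?_, fun h => ?_⟩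
  · rw [mem_support_iff, coeff_coeffDeriv] at hl
    rw [mem_support_iff]
    exact fun h => hl (by rw [h, map_zero])
  · have : m ∈ (coeffDeriv d p).support := by
      rw [h, mem_support_iff, hm]
      exact one_ne_zero
    rw [mem_support_iff, coeff_coeffDeriv, hm] at this
    exact this d.map_one_eq_zero

end CoefficientDerivation

section WeightLowering

variable {σ K : Type*} [Field K]

theorem weightedHomogeneousComponent_derivation_of_lowering {w : σ → ℕ} (hw : ∀ i, w i ≠ 0)
    {T : Derivation K (MvPolynomial σ K) (MvPolynomial σ K)}
    (hT : ∀ k p, IsWeightedHomogeneous w p (k + 1) → IsWeightedHomogeneous w (T p) k)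
    (k : ℕ) (p : MvPolynomial σ K) :
    weightedHomogeneousComponent w k (T p) = T (weightedHomogeneousComponent w (k + 1) p) := by
  classical
  induction p using MvPolynomial.induction_on' with
  | add p q hp hq => simp only [map_add, hp, hq]
  | monomial m a =>
    have hm := isWeightedHomogeneous_monomial w m a rfl
    rw [weightedHomogeneousComponent_of_mem ((mem_weightedHomogeneousSubmodule _ _ _ _).2 hm)]
    rcases h : Finsupp.weight w m with _ | l
    · obtain rfl : m = 0 :=
        Finsupp.ext ((weightedDegree_eq_zero_iff (nonTorsionWeight_of hw)).1 h)
      rw [show T (monomial 0 a) = 0 from T.map_algebraMap a]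
      simp
    · rw [h] at hm
      rw [weightedHomogeneousComponent_of_mem
        ((mem_weightedHomogeneousSubmodule _ _ _ _).2 (hT _ _ hm))]
      by_cases hk : k = l
      · simp [hk]
      · rw [if_neg hk, if_neg (by simpa using hk), map_zero]

theorem eq_C_of_weightedHomogeneousComponent_eq_zero {w : σ → ℕ} (hw : ∀ i, w i ≠ 0)
    {p : MvPolynomial σ K} (h : ∀ k, 0 < k → weightedHomogeneousComponent w k p = 0) :
    p = C (coeff 0 p) := by
  rw [← weightedHomogeneousComponent_zero (w := w) p hw]
  conv_lhs => rw [← sum_weightedHomogeneousComponent w p]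
  exact finsum_eq_single _ 0 fun k hk => h k (Nat.pos_of_ne_zero hk)

variable [CharZero K] (d : Derivation ℚ K K) {ι : Type*} [Fintype ι]

/-- The derivation on polynomials acting on coefficients through `d`, perturbed by a
combination of derivations that kill the coefficients. -/
noncomputable def perturbedDeriv (f : ι → K)
    (T : ι → Derivation K (MvPolynomial σ K) (MvPolynomial σ K)) (p : MvPolynomial σ K) :
    MvPolynomial σ K :=
  coeffDeriv d p + ∑ j, C (f j) * T j p

variable {d} {f : ι → K} {T : ι → Derivation K (MvPolynomial σ K) (MvPolynomial σ K)} {w : σ → ℕ}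

theorem weightedHomogeneousComponent_perturbedDeriv (hw : ∀ i, w i ≠ 0)
    (hT : ∀ j k p, IsWeightedHomogeneous w p (k + 1) → IsWeightedHomogeneous w (T j p) k)
    (k : ℕ) (p : MvPolynomial σ K) :
    weightedHomogeneousComponent w k (perturbedDeriv d f T p) =
      coeffDeriv d (weightedHomogeneousComponent w k p) +
        ∑ j, C (f j) * T j (weightedHomogeneousComponent w (k + 1) p) := by
  simp only [perturbedDeriv, map_add, map_sum, weightedHomogeneousComponent_coeffDeriv,
    weightedHomogeneousComponent_C_mul,
    weightedHomogeneousComponent_derivation_of_lowering hw (hT _)]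

theorem eq_zero_of_coeffDeriv_eq_zero_of_sum_eq
    (hδ : ∀ j p, coeffDeriv d (T j p) = T j (coeffDeriv d p))
    (hf : ∀ (c : ι → K) (g : K), (∀ j, d (c j) = 0) → ∑ j, c j * f j = d g → ∀ j, c j = 0)
    {q r : MvPolynomial σ K} (hq : coeffDeriv d q = 0)
    (hqr : coeffDeriv d r + ∑ j, C (f j) * T j q = 0) (j : ι) : T j q = 0 := by
  ext m
  rw [coeff_zero]
  refine hf (fun j => coeff m (T j q)) (-coeff m r) (fun j => ?_) ?_ j
  · rw [← coeff_coeffDeriv, hδ, hq, map_zero, coeff_zero]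
  · have := congrArg (coeff m) hqr
    simp only [coeff_add, coeff_coeffDeriv, coeff_sum, coeff_C_mul, coeff_zero] at this
    rw [map_neg, eq_neg_iff_add_eq_zero, add_comm, ← this]
    simp only [mul_comm]

/-- A polynomial ring with a perturbed derivation is a simple differential ring as soon as the
perturbing derivations lower weights, commute with the derivation of the coefficients and
have no common kernel in positive weight, and the perturbing coefficients satisfy
condition (C). -/
theorem eq_top_of_perturbedDeriv_mem (hw : ∀ i, w i ≠ 0)
    (hT : ∀ j k p, IsWeightedHomogeneous w p (k + 1) → IsWeightedHomogeneous w (T j p) k)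
    (hδ : ∀ j p, coeffDeriv d (T j p) = T j (coeffDeriv d p))
    (hker : ∀ k q, IsWeightedHomogeneous w q (k + 1) → (∀ j, T j q = 0) → q = 0)
    (hf : ∀ (c : ι → K) (g : K), (∀ j, d (c j) = 0) → ∑ j, c j * f j = d g → ∀ j, c j = 0)
    {J : Ideal (MvPolynomial σ K)} (hJ : ∀ p ∈ J, perturbedDeriv d f T p ∈ J) (hJ0 : J ≠ ⊥) :
    J = ⊤ := by
  classical
  let H := weightedHomogeneousComponent (R := K) w
  obtain ⟨⟨W, p⟩, ⟨hpJ, hp0, hpW⟩, hmin⟩ := exists_minimalFor_of_wellFoundedLT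
    (fun a : ℕ × MvPolynomial σ K => a.2 ∈ J ∧ a.2 ≠ 0 ∧ ∀ k, a.1 < k → H k a.2 = 0)
    (fun a => toLex (a.1, (H a.1 a.2).support.card)) (by
      obtain ⟨p, hp, hp0⟩ := Submodule.exists_mem_ne_zero_of_ne_bot hJ0
      exact ⟨(weightedTotalDegree w p, p), hp, hp0,
        fun k hk => weightedHomogeneousComponent_eq_zero k p hk⟩)
  have hmin' : ∀ V q, q ∈ J → (∀ k, V < k → H k q = 0) →
      toLex (V, (H V q).support.card) < toLex (W, (H W p).support.card) → q = 0 := by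
    intro V q hq hV hlt
    by_contra hq0
    exact hlt.not_ge (hmin (j := (V, q)) ⟨hq, hq0, hV⟩ hlt.le)
  have hdrop : ∀ q ∈ J, (∀ k, W < k → H k q = 0) → H W q = 0 → W ≠ 0 → q = 0 := by
    intro q hq hk h0 hW
    refine hmin' (W - 1) q hq (fun k hk' => ?_) (Prod.Lex.toLex_lt_toLex.2 (Or.inl ?_))
    · obtain rfl | h : k = W ∨ W < k := by omega
      exacts [h0, hk k h]
    · change W - 1 < W
      omega
  rcases Nat.eq_zero_or_eq_succ_pred W with hW | hW
  · have hp := eq_C_of_weightedHomogeneousComponent_eq_zero hw (p := p) (by simpa [hW] using hpW)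
    refine Ideal.eq_top_of_isUnit_mem _ hpJ ?_
    rw [hp] at hp0 ⊢
    exact (isUnit_iff_ne_zero.2 fun h => hp0 (by rw [h, C_0])).map C
  exfalso
  have hqp : H W p ≠ 0 := fun h => hp0 (hdrop p hpJ hpW h (by omega))
  obtain ⟨m, hm⟩ := ne_zero_iff.1 hqp
  let a := (coeff m (H W p))⁻¹
  have ha : a ≠ 0 := inv_ne_zero hm
  let s := C a * p
  have hHs : ∀ k, H k s = C a * H k p := fun k => weightedHomogeneousComponent_C_mul _ _ _
  have hsJ : s ∈ J := J.mul_mem_left _ hpJ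
  have hsW : ∀ k, W < k → H k s = 0 := fun k hk => by rw [hHs, hpW k hk, mul_zero]
  have hsm : coeff m (H W s) = 1 := by rw [hHs, coeff_C_mul, inv_mul_cancel₀ hm]
  have hcard : (H W s).support.card ≤ (H W p).support.card := by
    refine Finset.card_le_card fun l hl => ?_
    rw [mem_support_iff, hHs, coeff_C_mul] at hl
    exact mem_support_iff.2 (right_ne_zero_of_mul hl)
  have hcomp : ∀ k, H k (perturbedDeriv d f T s) =
      coeffDeriv d (H k s) + ∑ j, C (f j) * T j (H (k + 1) s) :=
    fun k => weightedHomogeneousComponent_perturbedDeriv hw hT k s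
  have htop : H W (perturbedDeriv d f T s) = coeffDeriv d (H W s) := by
    simp [hcomp, hsW]
  have hzero : perturbedDeriv d f T s = 0 := by
    refine hmin' W _ (hJ s hsJ) (fun k hk => ?_) (Prod.Lex.toLex_lt_toLex.2 (Or.inr ⟨rfl, ?_⟩))
    · simp [hcomp, hsW k hk, hsW (k + 1) (by omega), coeffDeriv_zero]
    · change (H W (perturbedDeriv d f T s)).support.card < _
      rw [htop]
      exact (card_support_coeffDeriv_lt d hsm).trans_le hcard
  rw [hzero, map_zero] at htop
  have hnext := hcomp W.pred
  rw [hzero, map_zero, ← Nat.succ_eq_add_one, ← hW] at hnext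
  have hT0 := eq_zero_of_coeffDeriv_eq_zero_of_sum_eq hδ hf htop.symm hnext.symm
  have hs0 : H W s = 0 := by
    refine hker W.pred _ ?_ hT0
    rw [← Nat.succ_eq_add_one, ← hW]
    exact weightedHomogeneousComponent_isWeightedHomogeneous W s
  rw [hs0, coeff_zero] at hsm
  exact zero_ne_one hsm

end WeightLowering

section TriangularShift

/-- The pairs `(i, j)` with `1 ≤ i`, `1 ≤ j` and `i + j ≤ n + 1`. -/
abbrev TriangularIndex (n : ℕ) : Type :=
  {p : ℕ × ℕ // 1 ≤ p.1 ∧ 1 ≤ p.2 ∧ p.1 + p.2 ≤ n + 1}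

instance (n : ℕ) : Finite (TriangularIndex n) :=
  Set.Finite.to_subtype <| ((Set.finite_Iic (n + 1)).prod (Set.finite_Iic (n + 1))).subset
    fun p hp => by
      have : 1 ≤ p.1 ∧ 1 ≤ p.2 ∧ p.1 + p.2 ≤ n + 1 := hp
      exact ⟨by simp only [Set.mem_Iic]; omega, by simp only [Set.mem_Iic]; omega⟩

noncomputable instance (n : ℕ) : Fintype (TriangularIndex n) := Fintype.ofFinite _

theorem mkDerivation_eq_sum_mul_pderiv {σ K : Type*} [Fintype σ] [CommRing K]
    (g : σ → MvPolynomial σ K) (p : MvPolynomial σ K) :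
    mkDerivation K g p = ∑ i, g i * pderiv i p := by
  classical
  have hsum (q) : (∑ i, g i • pderiv i : Derivation K (MvPolynomial σ K) (MvPolynomial σ K)) q =
      ∑ i, g i * pderiv i q := by
    have := congrFun (map_sum (Derivation.coeFnAddMonoidHom (R := K) (A := MvPolynomial σ K)
      (M := MvPolynomial σ K)) (fun i => g i • pderiv i) Finset.univ) q
    exact this.trans (Finset.sum_apply _ _ _)
  have : mkDerivation K g = ∑ i, g i • pderiv i := derivation_ext fun i => by
    simp [hsum, pderiv_X, Pi.single_apply]
  rw [this, hsum]

theorem pderiv_pderiv_comm {σ K : Type*} [CommRing K] (i j : σ) (p : MvPolynomial σ K) :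
    pderiv i (pderiv j p) = pderiv j (pderiv i p) := by
  classical
  ext m
  obtain rfl | h := eq_or_ne i j
  · rfl
  · simp only [coeff_pderiv, Finsupp.add_apply, Finsupp.single_eq_of_ne h,
      Finsupp.single_eq_of_ne h.symm, add_right_comm m, add_zero, mul_right_comm]

variable {n : ℕ} {K : Type*} [Field K]

variable (K) in
/-- The variable `x_{i-1,j+1}` attached to `(i, j)`, read as `1` when `i = 1`. -/
noncomputable def shiftedVar (p : TriangularIndex n) : MvPolynomial (TriangularIndex n) K :=
  if h : p.1.1 = 1 then 1
  else X ⟨(p.1.1 - 1, p.1.2 + 1), by have := p.2; grind⟩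

variable (n K) in
/-- The derivation sending `x_{i,j}` to `x_{i-1,j+1}` for the given `j`, and the other variables
to zero. -/
noncomputable def shiftDeriv (j : ℕ) :
    Derivation K (MvPolynomial (TriangularIndex n) K) (MvPolynomial (TriangularIndex n) K) :=
  mkDerivation K fun p => if p.1.2 = j then shiftedVar K p else 0

theorem isWeightedHomogeneous_shiftedVar (p : TriangularIndex n) :
    IsWeightedHomogeneous (fun q : TriangularIndex n => q.1.1) (shiftedVar K p) (p.1.1 - 1) := by
  unfold shiftedVar
  split_ifs with h
  · rw [h]
    exact isWeightedHomogeneous_one _ _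
  · exact isWeightedHomogeneous_X K _ _

theorem isWeightedHomogeneous_shiftDeriv (j k : ℕ) {q : MvPolynomial (TriangularIndex n) K}
    (hq : IsWeightedHomogeneous (fun p : TriangularIndex n => p.1.1) q (k + 1)) :
    IsWeightedHomogeneous (fun p : TriangularIndex n => p.1.1) (shiftDeriv n K j q) k := by
  rw [shiftDeriv, mkDerivation_eq_sum_mul_pderiv]
  refine IsWeightedHomogeneous.sum _ _ _ fun p _ => ?_
  split_ifs
  · have hp := p.2.1
    by_cases hk : p.1.1 ≤ k + 1
    · have := (isWeightedHomogeneous_shiftedVar (K := K) p).mul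
        (hq.pderiv (i := p) (n' := k + 1 - p.1.1) (by omega))
      rwa [show p.1.1 - 1 + (k + 1 - p.1.1) = k by omega] at this
    · have : pderiv p q = 0 := by
        ext m
        rw [coeff_pderiv, coeff_zero, hq.coeff_eq_zero, zero_mul]
        rw [map_add, Finsupp.weight_single]
        simp only [smul_eq_mul, one_mul]
        omega
      rw [this, mul_zero]
      exact isWeightedHomogeneous_zero _ _ _
  · rw [zero_mul]
    exact isWeightedHomogeneous_zero _ _ _

theorem coeffDeriv_shiftDeriv [CharZero K] (d : Derivation ℚ K K) (j : ℕ)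
    (q : MvPolynomial (TriangularIndex n) K) :
    coeffDeriv d (shiftDeriv n K j q) = shiftDeriv n K j (coeffDeriv d q) := by
  simp only [shiftDeriv, mkDerivation_eq_sum_mul_pderiv, coeffDeriv_sum, shiftedVar]
  refine Finset.sum_congr rfl fun p _ => ?_
  split_ifs
  · rw [one_mul, one_mul, coeffDeriv_pderiv]
  · rw [mul_comm, coeffDeriv_mul_X, coeffDeriv_pderiv, mul_comm]
  · rw [zero_mul, zero_mul, coeffDeriv_zero]

theorem pderiv_eq_zero_of_shiftDeriv_eq_zero {q : MvPolynomial (TriangularIndex n) K}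
    (hq : ∀ j, 1 ≤ j → j ≤ n → shiftDeriv n K j q = 0) (p : TriangularIndex n) :
    pderiv p q = 0 := by
  classical
  obtain ⟨k, hk⟩ : ∃ k, k = n - p.1.2 := ⟨_, rfl⟩
  induction k using Nat.strong_induction_on generalizing p with
  | _ k ih =>
  have hprev : ∀ r : TriangularIndex n, r.1.2 = p.1.2 + 1 → pderiv r q = 0 := fun r hr =>
    ih (n - r.1.2) (by have := r.2; omega) r rfl
  have hsum : ∑ r, (if r.1.2 = p.1.2 then shiftedVar K r else 0) * pderiv r q = 0 := by
    rw [← mkDerivation_eq_sum_mul_pderiv]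
    exact hq _ p.2.2.1 (by have := p.2; omega)
  have hbig : ∀ r : TriangularIndex n, r.1.2 = p.1.2 → r.1.1 ≠ 1 → pderiv r q = 0 := by
    intro r hr hr1
    let t : TriangularIndex n := ⟨(r.1.1 - 1, r.1.2 + 1), by have := r.2; grind⟩
    have ht : ∀ u, pderiv t (pderiv u q) = 0 := fun u => by
      rw [pderiv_pderiv_comm, hprev t (by simp [t, hr]), map_zero]
    have := congrArg (pderiv t) hsum
    rw [map_sum, map_zero, Finset.sum_eq_single r] at this
    · rw [if_pos hr, shiftedVar, dif_neg hr1, pderiv_mul, ht, mul_zero, add_zero,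
        pderiv_X_self, one_mul] at this
      exact this
    · intro u _ hu
      rw [pderiv_mul, ht, mul_zero, add_zero]
      split_ifs with huj
      · rw [shiftedVar]
        split_ifs with hu1
        · rw [pderiv_one, zero_mul]
        · rw [pderiv_X_of_ne, zero_mul]
          intro h
          apply hu
          have h1 := congrArg (fun z : TriangularIndex n => z.1.1) h
          have hu' := u.2
          have hr' := r.2
          simp only [t] at h1
          exact Subtype.ext (Prod.ext (by omega) (by omega))
      · rw [map_zero, zero_mul]
    · exact fun h => absurd (Finset.mem_univ r) h
  by_cases hp1 : p.1.1 = 1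
  · rw [Finset.sum_eq_single p] at hsum
    · simpa [shiftedVar, hp1] using hsum
    · intro u _ hu
      split_ifs with huj
      · rw [hbig u huj fun h => hu (Subtype.ext (Prod.ext (h.trans hp1.symm) huj)), mul_zero]
      · rw [zero_mul]
    · exact fun h => absurd (Finset.mem_univ p) h
  · exact hbig p rfl hp1

theorem eq_zero_of_shiftDeriv_eq_zero [CharZero K] {k : ℕ}
    {q : MvPolynomial (TriangularIndex n) K}
    (hqk : IsWeightedHomogeneous (fun p : TriangularIndex n => p.1.1) q (k + 1))
    (hq : ∀ j, 1 ≤ j → j ≤ n → shiftDeriv n K j q = 0) : q = 0 := by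
  have := hqk.sum_weight_X_mul_pderiv
  simp only [pderiv_eq_zero_of_shiftDeriv_eq_zero hq, mul_zero, smul_zero,
    Finset.sum_const_zero] at this
  exact (smul_eq_zero.1 this.symm).resolve_left (by omega)

end TriangularShift

/-- The restriction of a derivation of a field to a subfield it preserves. -/
def Derivation.restrictSubfield {E : Type*} [Field E] [CharZero E] (D : Derivation ℚ E E)
    (F : Subfield E) (hF : ∀ a ∈ F, D a ∈ F) : Derivation ℚ F F :=
  Derivation.mk'
    { toFun := fun a => ⟨D a, hF a a.2⟩
      map_add' := fun a b => Subtype.ext (by simp)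
      map_smul' := fun c a => Subtype.ext (D.map_smul c (a : E)) }
    fun a b => Subtype.ext (by simp)

theorem derivation_aeval_eq_aeval_perturbedDeriv {E : Type*} [Field E] [CharZero E]
    (D : Derivation ℚ E E) (F : Subfield E) (hF : ∀ a ∈ F, D a ∈ F) {σ ι : Type*} [Fintype ι]
    (f : ι → F) (T : ι → Derivation F (MvPolynomial σ F) (MvPolynomial σ F)) (y : σ → E)
    (hy : ∀ i, D (y i) = aeval y (∑ j, C (f j) * T j (X i))) (p : MvPolynomial σ F) :
    D (aeval y p) = aeval y (perturbedDeriv (D.restrictSubfield F hF) f T p) := by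
  induction p using MvPolynomial.induction_on with
  | C a =>
    simp [perturbedDeriv, coeffDeriv_C]
    rfl
  | add p q hp hq =>
    simp only [map_add, hp, hq, perturbedDeriv, coeffDeriv_add, mul_add, Finset.sum_add_distrib]
    ring
  | mul_X p i hp =>
    rw [map_mul, D.leibniz, hp, aeval_X, hy]
    simp only [perturbedDeriv, coeffDeriv_mul_X, Derivation.leibniz, smul_eq_mul, map_add,
      map_mul, map_sum, aeval_X, mul_add, Finset.sum_add_distrib, Finset.mul_sum]
    rw [add_comm, add_assoc, add_comm (Finset.sum _ _)]
    congr 1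
    · ring
    · congr 1 <;> refine Finset.sum_congr rfl fun j _ => by ring

/-- For the extension `E = F(x_{i,j})` built from `f₁, …, fₙ`
satisfying condition (C), the `F`-subalgebra `R = F[x_{i,j}]` of `E` generated by the
`x_{i,j}` is closed under the derivation, and it is a simple differential ring: every
ideal of `R` closed under the derivation is `{0}` or `R`. -/
theorem picard_vessiot_ring_simple
    (E : Type) [Field E] [CharZero E] (D : Derivation ℚ E E)
    (F : Subfield E) (hF : ∀ a ∈ F, D a ∈ F)
    (n : ℕ) (f : ℕ → E) (hf : ∀ j, 1 ≤ j → j ≤ n → f j ∈ F)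
    (hcondC : ∀ (c : ℕ → E) (g : E),
      (∀ j, 1 ≤ j → j ≤ n → c j ∈ F ∧ D (c j) = 0) → g ∈ F →
      (∑ j ∈ Finset.Icc 1 n, c j * f j) = D g → ∀ j, 1 ≤ j → j ≤ n → c j = 0)
    (x : ℕ → ℕ → E)
    (hind : AlgebraicIndependent F
      (fun p : {p : ℕ × ℕ // 1 ≤ p.1 ∧ 1 ≤ p.2 ∧ p.1 + p.2 ≤ n + 1} => x p.1.1 p.1.2))
    (hgen : Subfield.closure
      (↑F ∪ {a | ∃ i j, 1 ≤ i ∧ 1 ≤ j ∧ i + j ≤ n + 1 ∧ a = x i j}) = ⊤)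
    (hd1 : ∀ j, 1 ≤ j → j ≤ n → D (x 1 j) = f j)
    (hdi : ∀ i j, 2 ≤ i → 1 ≤ j → i + j ≤ n + 1 → D (x i j) = f j * x (i - 1) (j + 1))
    (R : Subring E)
    (hR : R = Subring.closure
      (↑F ∪ {a | ∃ i j, 1 ≤ i ∧ 1 ≤ j ∧ i + j ≤ n + 1 ∧ a = x i j}))
    (hRD : ∀ a ∈ R, D a ∈ R) :
    ∀ I : Ideal R, (∀ a : R, a ∈ I → (⟨D ↑a, hRD ↑a a.2⟩ : R) ∈ I) →
      I = ⊥ ∨ I = ⊤ := by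
  intro I hI
  let y : TriangularIndex n → E := fun p => x p.1.1 p.1.2
  have hyR : (aeval (R := F) y).toRingHom.range = R := by
    apply le_antisymm
    · rintro _ ⟨p, rfl⟩
      change aeval y p ∈ R
      rw [hR]
      induction p using MvPolynomial.induction_on with
      | C a =>
        rw [aeval_C]
        exact Subring.subset_closure (Or.inl a.2)
      | add p q hp hq => rw [map_add]; exact add_mem hp hq
      | mul_X p i hp =>
        rw [map_mul, aeval_X]
        exact mul_mem hp
          (Subring.subset_closure (Or.inr ⟨_, _, i.2.1, i.2.2.1, i.2.2.2, rfl⟩))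
    · rw [hR, Subring.closure_le]
      rintro a (ha | ⟨i, j, hi, hj, hij, rfl⟩)
      · exact ⟨C ⟨a, ha⟩, aeval_C _ _⟩
      · exact ⟨X ⟨(i, j), hi, hj, hij⟩, aeval_X _ _⟩
  let φ : MvPolynomial (TriangularIndex n) F →+* R :=
    (aeval (R := F) y).toRingHom.codRestrict R fun p => hyR ▸ ⟨p, rfl⟩
  have hφ (p) : (φ p : E) = aeval y p := rfl
  have hφsurj : Function.Surjective φ := fun a => by
    obtain ⟨p, hp⟩ : (a : E) ∈ (aeval (R := F) y).toRingHom.range := hyR ▸ a.2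
    exact ⟨p, Subtype.ext hp⟩
  let fF : Finset.Icc 1 n → F := fun j =>
    ⟨f j, hf j (Finset.mem_Icc.1 j.2).1 (Finset.mem_Icc.1 j.2).2⟩
  let T : Finset.Icc 1 n → Derivation F (MvPolynomial (TriangularIndex n) F)
    (MvPolynomial (TriangularIndex n) F) := fun j => shiftDeriv n F j
  have hy (p : TriangularIndex n) : D (y p) = aeval y (∑ j, C (fF j) * T j (X p)) := by
    have hp := p.2
    rw [Finset.sum_eq_single ⟨p.1.2, Finset.mem_Icc.2 (by omega)⟩]
    · simp only [T, fF, shiftDeriv, mkDerivation_X, if_true, map_mul, aeval_C, shiftedVar]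
      split_ifs with h
      · rw [map_one, mul_one]
        simp only [y, h]
        exact hd1 _ hp.2.1 (by omega)
      · rw [aeval_X]
        exact hdi _ _ (by omega) hp.2.1 hp.2.2
    · intro j _ hj
      have : p.1.2 ≠ j := fun h => hj (Subtype.ext h.symm)
      simp [T, shiftDeriv, this]
    · exact fun h => absurd (Finset.mem_univ _) h
  have hC (c : Finset.Icc 1 n → F) (g : F)
      (hc : ∀ j, D.restrictSubfield F hF (c j) = 0)
      (hg : ∑ j, c j * fF j = D.restrictSubfield F hF g) (j) : c j = 0 := by
    let c' : ℕ → E := fun j => if h : j ∈ Finset.Icc 1 n then c ⟨j, h⟩ else 0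
    have hc' (j : Finset.Icc 1 n) : c' j = c j := dif_pos j.2
    have hj := Finset.mem_Icc.1 j.2
    apply Subtype.ext
    rw [← hc']
    refine hcondC c' g (fun i h1 hn => ?_) g.2 ?_ j hj.1 hj.2
    · have := hc' ⟨i, Finset.mem_Icc.2 ⟨h1, hn⟩⟩
      simp only at this
      rw [this]
      exact ⟨(c _).2, congrArg Subtype.val (hc ⟨i, _⟩)⟩
    · rw [← Finset.sum_coe_sort]
      simp only [hc']
      have := congrArg Subtype.val hg
      simpa [fF] using! this
  by_cases hJ0 : I.comap φ = ⊥
  · left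
    rw [← Ideal.map_comap_of_surjective φ hφsurj I, hJ0, Ideal.map_bot]
  · right
    have hJ := eq_top_of_perturbedDeriv_mem (d := D.restrictSubfield F hF) (f := fF) (T := T)
      (w := fun p => p.1.1) (fun p => by have := p.2.1; omega)
      (fun j k _ => isWeightedHomogeneous_shiftDeriv j k) (fun j => coeffDeriv_shiftDeriv _ j)
      (fun k q hq hT => eq_zero_of_shiftDeriv_eq_zero hq fun j h1 hn =>
        hT ⟨j, Finset.mem_Icc.2 ⟨h1, hn⟩⟩) hC (J := I.comap φ) (fun p hp => ?_) hJ0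
    · rw [← Ideal.map_comap_of_surjective φ hφsurj I, hJ, Ideal.map_top]
    · have := hI _ (Ideal.mem_comap.1 hp)
      rw [Ideal.mem_comap]
      convert this using 1
      apply Subtype.ext
      rw [hφ, ← derivation_aeval_eq_aeval_perturbedDeriv D F hF fF T y hy, ← hφ]
end
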